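/- arXiv:2310.00211 — 11 statements merged into one kernel-verified Lean document; each statement's English description precedes it below -/
import Mathlib

section
/- Let p ≥ 1 and let Y ⊆ ℝ^p be a set with non-empty interior. If two unit vectors x, x' ∈ S^{p−1} are equivalent with respect to Y, then x = x'. -/
open scoped RealInnerProductSpace

/-- Let `p ≥ 1` and let `Y ⊆ ℝ^p` have non-empty interior.
If two unit vectors `x, x'` are equivalent with respect to `Y` (they induce the
same ordinal comparisons of inner products with pairs of points of `Y`),
then `x = x'`. -/
theorem external_unfolding_vector_model
    (p : ℕ) (hp : 1 ≤ p) (Y : Set (EuclideanSpace ℝ (Fin p)))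
    (hY : (interior Y).Nonempty)
    (x x' : EuclideanSpace ℝ (Fin p)) (hx : ‖x‖ = 1) (hx' : ‖x'‖ = 1)
    (hequiv : ∀ y ∈ Y, ∀ y' ∈ Y,
      (⟪x, y⟫ < ⟪x, y'⟫ ↔ ⟪x', y⟫ < ⟪x', y'⟫)) :
    x = x' := by
  obtain ⟨c, hc⟩ := hY
  obtain ⟨r, hr, hball⟩ := Metric.isOpen_iff.mp isOpen_interior c hc
  have hmem : c + (r / 3) • (x - x') ∈ Y := by
    apply interior_subset
    apply hball
    rw [Metric.mem_ball, dist_eq_norm, add_sub_cancel_left, norm_smul,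
      Real.norm_of_nonneg (by positivity)]
    have := norm_sub_le x x'
    rw [hx, hx'] at this
    nlinarith
  have key := hequiv c (interior_subset hc) _ hmem
  simp only [inner_add_right, inner_smul_right, inner_sub_right, real_inner_self_eq_norm_sq, hx,
    hx', lt_add_iff_pos_right, real_inner_comm x x'] at key
  by_contra hne
  have hlt : ⟪x, x'⟫ < 1 := (inner_lt_one_iff_real_of_norm_eq_one hx hx').mpr hne
  have h := key.mp (mul_pos (by positivity) (by linarith))
  nlinarith [real_inner_comm x x']
end

section
/- Let p ≥ 1 and let f : ℝ^p → ℝ^p be a bijective map that is weakly isotonic (with X = ℝ^p). Then f is a similarity transformation of ℝ^p. -/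
/-- A surjective map of a strictly convex real normed space that preserves and reflects equality of
distances from a common point preserves midpoints. -/
theorem map_midpoint_of_dist_eq_iff {E : Type*} [NormedAddCommGroup E] [NormedSpace ℝ E]
    [StrictConvexSpace ℝ E] {f : E → E} (hsurj : Function.Surjective f)
    (heq : ∀ x y z : E, ‖x - y‖ = ‖x - z‖ ↔ ‖f x - f y‖ = ‖f x - f z‖) (x y : E) :
    f (midpoint ℝ x y) = midpoint ℝ (f x) (f y) := by
  set m := midpoint ℝ x y with hm
  have hxm : dist x m = dist x y / 2 := by
    rw [hm, dist_left_midpoint, Real.norm_ofNat]; ring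
  have hmy : dist m y = dist x y / 2 := by
    rw [hm, dist_midpoint_right, Real.norm_ofNat]; ring
  have hm_eq : ‖f m - f x‖ = ‖f m - f y‖ := by
    rw [← heq, ← dist_eq_norm, ← dist_eq_norm, dist_comm m x, hxm, hmy]
  obtain ⟨z, hz⟩ := hsurj (f x + f y - f m)
  have hxz : ‖x - z‖ = ‖x - m‖ := by
    rw [heq, hz, norm_sub_rev (f x) (f m), hm_eq]
    congr 1
    abel
  have hyz : ‖y - z‖ = ‖y - m‖ := by
    rw [heq, hz, norm_sub_rev (f y) (f m), ← hm_eq]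
    congr 1
    abel
  have hzm : z = m := by
    apply eq_midpoint_of_dist_eq_half
    · rw [dist_eq_norm, hxz, ← dist_eq_norm, hxm]
    · rw [dist_comm, dist_eq_norm, hyz, ← dist_eq_norm, dist_comm, hmy]
  rw [hzm] at hz
  rw [midpoint_eq_smul_add, ← eq_sub_iff_add_eq.mp hz, ← two_smul ℝ (f m), invOf_smul_smul]

/-- A surjective additive endomorphism of a nontrivial real normed space that preserves the strict
order of norms is continuous. -/
theorem AddMonoidHom.continuous_of_norm_lt_norm {E : Type*} [NormedAddCommGroup E]
    [NormedSpace ℝ E] [Nontrivial E] (A : E →+ E) (hsurj : Function.Surjective A)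
    (hlt : ∀ x y : E, ‖x‖ < ‖y‖ → ‖A x‖ < ‖A y‖) : Continuous A := by
  refine continuous_of_continuousAt_zero A (Metric.continuousAt_iff.mpr fun ε hε => ?_)
  obtain ⟨w, hw⟩ := exists_norm_eq E (half_pos hε).le
  obtain ⟨y, rfl⟩ := hsurj w
  have hy : y ≠ 0 := by
    rintro rfl
    rw [map_zero, norm_zero] at hw
    linarith
  refine ⟨‖y‖, norm_pos_iff.mpr hy, fun {x} hx => ?_⟩
  rw [dist_zero_right] at hx
  rw [map_zero, dist_zero_right]
  linarith [hlt x y hx]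

/-- A linear endomorphism of a nontrivial real normed space that preserves the strict order of norms
and equality of norms multiplies the norm by a positive constant. -/
theorem LinearMap.exists_norm_map_eq_mul_norm {E : Type*} [NormedAddCommGroup E]
    [NormedSpace ℝ E] [Nontrivial E] (A : E →ₗ[ℝ] E)
    (hlt : ∀ x y : E, ‖x‖ < ‖y‖ → ‖A x‖ < ‖A y‖)
    (heq : ∀ x y : E, ‖x‖ = ‖y‖ → ‖A x‖ = ‖A y‖) :
    ∃ c > (0 : ℝ), ∀ x : E, ‖A x‖ = c * ‖x‖ := by
  obtain ⟨e, he⟩ := exists_norm_eq E zero_le_one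
  refine ⟨‖A e‖, ?_, fun x => ?_⟩
  · simpa using hlt 0 e (by simp [he])
  · rw [heq x (‖x‖ • e) (by simp [norm_smul, he]), map_smul, norm_smul, norm_norm, mul_comm]

/-- **Proposition of Shepard.** Let `p ≥ 1` and let
`f : ℝ^p → ℝ^p` be a bijective, weakly isotonic map. Then `f` is a similarity
transformation: there is `c > 0` with `‖f u - f v‖ = c * ‖u - v‖` for all `u, v`. -/
theorem shepard_mds
    (p : ℕ) (hp : 1 ≤ p) (f : EuclideanSpace ℝ (Fin p) → EuclideanSpace ℝ (Fin p))
    (hbij : Function.Bijective f)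
    (hiso : ∀ x x' x'' : EuclideanSpace ℝ (Fin p),
      (‖x - x'‖ < ‖x - x''‖ ↔ ‖f x - f x'‖ < ‖f x - f x''‖)) :
    ∃ c > (0 : ℝ), ∀ u v : EuclideanSpace ℝ (Fin p), ‖f u - f v‖ = c * ‖u - v‖ := by
  have heq : ∀ x y z, ‖x - y‖ = ‖x - z‖ ↔ ‖f x - f y‖ = ‖f x - f z‖ := fun x y z => by
    rw [le_antisymm_iff, le_antisymm_iff, ← not_lt, ← not_lt, ← not_lt, ← not_lt, hiso x y z,
      hiso x z y]
  have : Nonempty (Fin p) := ⟨⟨0, hp⟩⟩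
  let A : EuclideanSpace ℝ (Fin p) →+ EuclideanSpace ℝ (Fin p) :=
    AddMonoidHom.ofMapMidpoint ℝ ℝ (fun x => f x - f 0) (sub_self _) fun x y => by
      rw [map_midpoint_of_dist_eq_iff hbij.2 heq, midpoint_eq_smul_add, midpoint_eq_smul_add,
        invOf_eq_inv]
      module
  have hA : ∀ x, A x = f x - f 0 := fun _ => rfl
  have hlt : ∀ x y, ‖x‖ < ‖y‖ → ‖A x‖ < ‖A y‖ := fun x y h => by
    rw [hA, hA, norm_sub_rev (f x), norm_sub_rev (f y), ← hiso]
    simpa using h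
  have heqA : ∀ x y, ‖x‖ = ‖y‖ → ‖A x‖ = ‖A y‖ := fun x y h => by
    rw [hA, hA, norm_sub_rev (f x), norm_sub_rev (f y), ← heq]
    simpa using h
  have hsurj : Function.Surjective A := fun w => by
    obtain ⟨x, hx⟩ := hbij.2 (w + f 0)
    exact ⟨x, by rw [hA, hx, add_sub_cancel_right]⟩
  obtain ⟨c, hc, h⟩ := LinearMap.exists_norm_map_eq_mul_norm
    (A.toRealLinearMap (A.continuous_of_norm_lt_norm hsurj hlt)).toLinearMap hlt heqA
  refine ⟨c, hc, fun u v => ?_⟩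
  rw [← h, ← sub_sub_sub_cancel_right (f u) (f v) (f 0), ← hA, ← hA, ← map_sub]
  rfl
end

section
/- Let p ≥ 1 and let f, g : ℝ^p → ℝ^p form an isotonic unfolding pair on (ℝ^p, ℝ^p) such that g is surjective (hence bijective). Then there exists a similarity transformation L of ℝ^p such that f = L and g = L. -/
/-- A point equidistant from `a` and `b` and different from their midpoint is further from `a` than
the midpoint is. -/
theorem norm_sub_midpoint_lt {E : Type*} [NormedAddCommGroup E] [NormedSpace ℝ E]
    [StrictConvexSpace ℝ E] {a b x : E} (h : ‖x - a‖ = ‖x - b‖) (hx : x ≠ midpoint ℝ a b) :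
    ‖a - midpoint ℝ a b‖ < ‖a - x‖ := by
  have h1 : ‖a - midpoint ℝ a b‖ = dist a b / 2 := by
    rw [← dist_eq_norm, dist_left_midpoint, Real.norm_ofNat]; ring
  rw [← dist_eq_norm, ← dist_eq_norm] at h
  rw [h1, ← dist_eq_norm]
  by_contra! hle
  have htri := dist_triangle a x b
  rw [dist_comm x a] at h
  exact hx (eq_midpoint_of_dist_eq_half (by linarith) (by linarith))

/-- A surjection which preserves the order of the distances from each point preserves midpoints. -/
theorem map_midpoint_of_norm_sub_lt_iff {E F : Type*} [NormedAddCommGroup E] [NormedSpace ℝ E]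
    [StrictConvexSpace ℝ E] [NormedAddCommGroup F] [NormedSpace ℝ F] {f : E → F}
    (hf : Function.Surjective f)
    (h : ∀ x y y', ‖x - y‖ < ‖x - y'‖ ↔ ‖f x - f y‖ < ‖f x - f y'‖) (a b : E) :
    f (midpoint ℝ a b) = midpoint ℝ (f a) (f b) := by
  have heq : ∀ x y y', ‖x - y‖ = ‖x - y'‖ ↔ ‖f x - f y‖ = ‖f x - f y'‖ := fun x y y' => by
    rw [le_antisymm_iff, le_antisymm_iff, ← not_lt, ← not_lt, h, h, not_lt, not_lt]
  obtain ⟨x, hx⟩ := hf (midpoint ℝ (f a) (f b))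
  have hxab : ‖x - a‖ = ‖x - b‖ := by
    rw [heq, hx, ← dist_eq_norm, ← dist_eq_norm, dist_midpoint_left, dist_midpoint_right]
  have hmab : ‖f (midpoint ℝ a b) - f a‖ = ‖f (midpoint ℝ a b) - f b‖ := by
    rw [← heq, ← dist_eq_norm, ← dist_eq_norm, dist_midpoint_left, dist_midpoint_right]
  by_contra hne
  have hxm : x ≠ midpoint ℝ a b := by
    rintro rfl
    exact hne hx
  have hlt := (h _ _ _).1 (norm_sub_midpoint_lt hxab hxm)
  rw [hx, ← dist_eq_norm, ← dist_eq_norm, dist_left_midpoint, Real.norm_ofNat] at hlt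
  rw [← dist_eq_norm, ← dist_eq_norm] at hmab
  have htri := dist_triangle (f a) (f (midpoint ℝ a b)) (f b)
  rw [dist_comm _ (f a)] at hmab
  linarith

/-- A surjective additive map which preserves the order of norms is continuous. -/
theorem AddMonoidHom.continuous_of_norm_lt_iff {E F : Type*} [NormedAddCommGroup E]
    [NormedAddCommGroup F] [NormedSpace ℝ F] [Nontrivial F] (φ : E →+ F)
    (hφ : Function.Surjective φ) (h : ∀ u v, ‖u‖ < ‖v‖ ↔ ‖φ u‖ < ‖φ v‖) : Continuous φ := by
  refine continuous_of_continuousAt_zero φ (Metric.continuousAt_iff.2 fun ε hε => ?_)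
  obtain ⟨w, hw⟩ := NormedSpace.exists_lt_norm ℝ F 0
  obtain ⟨v, hv⟩ := hφ ((ε / ‖w‖) • w)
  have hvε : ‖φ v‖ = ε := by
    rw [hv, norm_smul, Real.norm_of_nonneg (by positivity), div_mul_cancel₀ _ hw.ne']
  refine ⟨‖v‖, ?_, fun {u} hu => ?_⟩
  · rw [gt_iff_lt, ← norm_zero (E := E), h, map_zero, norm_zero, hvε]
    exact hε
  · rw [dist_zero_right] at hu
    rw [map_zero, dist_zero_right, ← hvε]
    exact (h _ _).1 hu

/-- A linear map which preserves the order of norms multiplies all norms by a constant. -/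
theorem LinearMap.exists_norm_eq_mul_of_norm_lt_iff {E F : Type*} [NormedAddCommGroup E]
    [NormedSpace ℝ E] [Nontrivial E] [NormedAddCommGroup F] [NormedSpace ℝ F] (φ : E →ₗ[ℝ] F)
    (h : ∀ u v, ‖u‖ < ‖v‖ ↔ ‖φ u‖ < ‖φ v‖) : ∃ c > (0 : ℝ), ∀ u, ‖φ u‖ = c * ‖u‖ := by
  obtain ⟨e, he⟩ := exists_norm_eq E zero_le_one
  refine ⟨‖φ e‖, ?_, fun u => ?_⟩
  · have h0 := (h 0 e).1 (by rw [norm_zero, he]; exact one_pos)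
    rwa [map_zero, norm_zero] at h0
  · have hue : ‖u‖ = ‖‖u‖ • e‖ := by rw [norm_smul, norm_norm, he, mul_one]
    have hφ : ‖φ u‖ = ‖φ (‖u‖ • e)‖ :=
      le_antisymm (not_lt.1 fun hlt => ((h _ _).2 hlt).ne hue.symm)
        (not_lt.1 fun hlt => ((h _ _).2 hlt).ne hue)
    rw [hφ, map_smul, norm_smul, norm_norm, mul_comm]

/-- A surjection which preserves the order of the distances from each point is a similarity. -/
theorem exists_norm_sub_eq_mul_of_norm_sub_lt_iff {E F : Type*} [NormedAddCommGroup E]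
    [NormedSpace ℝ E] [StrictConvexSpace ℝ E] [Nontrivial E] [NormedAddCommGroup F]
    [NormedSpace ℝ F] [Nontrivial F] {f : E → F} (hf : Function.Surjective f)
    (h : ∀ x y y', ‖x - y‖ < ‖x - y'‖ ↔ ‖f x - f y‖ < ‖f x - f y'‖) :
    ∃ c > (0 : ℝ), ∀ u v, ‖f u - f v‖ = c * ‖u - v‖ := by
  let φ : E →+ F := AddMonoidHom.ofMapMidpoint ℝ ℝ (fun x => f x - f 0) (sub_self _) fun a b => by
    rw [map_midpoint_of_norm_sub_lt_iff hf h, ← vsub_eq_sub, ← vsub_eq_sub, ← vsub_eq_sub, ← midpoint_vsub_midpoint,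
      midpoint_self]
  have hφ : ∀ x, φ x = f x - f 0 := fun _ => rfl
  have hφs : Function.Surjective φ := fun y => by
    obtain ⟨x, hx⟩ := hf (y + f 0)
    exact ⟨x, by rw [hφ, hx, add_sub_cancel_right]⟩
  have hlt : ∀ u v, ‖u‖ < ‖v‖ ↔ ‖φ u‖ < ‖φ v‖ := fun u v => by
    have := h 0 u v
    rwa [zero_sub, zero_sub, norm_neg, norm_neg, norm_sub_rev, norm_sub_rev (f 0)] at this
  obtain ⟨c, hc, hnorm⟩ := LinearMap.exists_norm_eq_mul_of_norm_lt_iff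
    (φ.toRealLinearMap (φ.continuous_of_norm_lt_iff hφs hlt) : E →ₗ[ℝ] F) hlt
  refine ⟨c, hc, fun u v => ?_⟩
  rw [← hnorm, ← sub_sub_sub_cancel_right (f u) (f v) (f 0), ← hφ, ← hφ, ← map_sub]
  rfl


/-- **Proposition: internal unfolding, Shepard's setting.**
Let `p ≥ 1` and let `f, g : ℝ^p → ℝ^p` be an isotonic unfolding pair on
`(ℝ^p, ℝ^p)` (both injective) with `g` surjective. Then there is a similarity
transformation `L` with `f = L` and `g = L`. -/
theorem shepard_internal_unfolding
    (p : ℕ) (hp : 1 ≤ p)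
    (f g : EuclideanSpace ℝ (Fin p) → EuclideanSpace ℝ (Fin p))
    (hf_inj : Function.Injective f) (hg_inj : Function.Injective g)
    (hg_surj : Function.Surjective g)
    (hpair : ∀ x y y' : EuclideanSpace ℝ (Fin p),
      (‖x - y‖ < ‖x - y'‖ ↔ ‖f x - g y‖ < ‖f x - g y'‖)) :
    ∃ L : EuclideanSpace ℝ (Fin p) → EuclideanSpace ℝ (Fin p),
      (∃ c > (0 : ℝ), ∀ u v, ‖L u - L v‖ = c * ‖u - v‖) ∧ f = L ∧ g = L := by
  have hfg : f = g := by
    funext x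
    obtain ⟨y, hy⟩ := hg_surj (f x)
    by_contra hne
    have hxy : x ≠ y := by
      rintro rfl
      exact hne hy.symm
    have hlt := (hpair x x y).1 (by
      rw [sub_self, norm_zero]
      exact norm_pos_iff.2 (sub_ne_zero.2 hxy))
    rw [hy, sub_self (f x), norm_zero] at hlt
    exact (norm_nonneg _).not_gt hlt
  subst hfg
  have : Nonempty (Fin p) := ⟨⟨0, hp⟩⟩
  exact ⟨f, exists_norm_sub_eq_mul_of_norm_sub_lt_iff hg_surj hpair, rfl, rfl⟩
end

section
/- Let p ≥ 1 and let f, g : ℝ^p → ℝ^p be injective maps satisfying g(S(x, ‖x − y‖)) = S(f(x), ‖f(x) − g(y)‖) for all x, y ∈ ℝ^p. If x, x', x'' ∈ ℝ^p are pairwise distinct, y, y', y'' ∈ ℝ^p are pairwise distinct, and the six points x, x', x'', y, y', y'' all lie on a common affine line, then the six points f(x), f(x'), f(x''), g(y), g(y'), g(y'') all lie on a common affine line. -/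
/-- A point on the line through `a` and `b` is determined by its distances to `a` and `b`. -/
theorem eq_of_mem_line_of_dist_eq {V : Type*} [NormedAddCommGroup V] [InnerProductSpace ℝ V]
    {a b y z : V} (hy : y ∈ line[ℝ, a, b]) (ha : ‖a - z‖ = ‖a - y‖) (hb : ‖b - z‖ = ‖b - y‖) :
    z = y := by
  obtain ⟨t, rfl⟩ := (mem_affineSpan_pair_iff_exists_lineMap_eq).1 hy
  obtain ⟨w, rfl⟩ : ∃ w, z = a + w := ⟨z - a, by abel⟩
  obtain ⟨v, rfl⟩ : ∃ v, b = a + v := ⟨b - a, by abel⟩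
  have hline : AffineMap.lineMap a (a + v) t = a + t • v := by
    simp [AffineMap.lineMap_apply, add_comm]
  rw [hline] at ha hb ⊢
  have h₁ : ‖w‖ ^ 2 = t ^ 2 * ‖v‖ ^ 2 := by
    have : ‖w‖ = ‖t • v‖ := by simpa using ha
    rw [this, norm_smul, mul_pow, Real.norm_eq_abs, sq_abs]
  have h₂ : ‖v - w‖ ^ 2 = (1 - t) ^ 2 * ‖v‖ ^ 2 := by
    have : ‖v - w‖ = ‖(1 - t) • v‖ := by simpa [sub_smul] using hb
    rw [this, norm_smul, mul_pow, Real.norm_eq_abs, sq_abs]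
  have h₃ : ‖w - t • v‖ ^ 2 = 0 := by
    rw [norm_sub_sq_real] at h₂ ⊢
    rw [inner_smul_right, norm_smul, mul_pow, Real.norm_eq_abs, sq_abs, real_inner_comm]
    linear_combination (1 - t) * h₁ + t * h₂
  have h₄ : w = t • v := by simpa [sub_eq_zero] using h₃
  rw [h₄]

/-- A point that is the only one with its distances to `a` and `b` lies on the line through
`a` and `b`. -/
theorem mem_line_of_forall_dist_eq {V : Type*} [NormedAddCommGroup V] [InnerProductSpace ℝ V]
    {a b y : V} (h : ∀ z, ‖a - z‖ = ‖a - y‖ → ‖b - z‖ = ‖b - y‖ → z = y) :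
    y ∈ line[ℝ, a, b] := by
  rw [← EuclideanGeometry.reflection_eq_self_iff]
  apply h <;> rw [← dist_eq_norm, ← dist_eq_norm]
  · exact EuclideanGeometry.dist_reflection_eq_of_mem _ (left_mem_affineSpan_pair ℝ a b) y
  · exact EuclideanGeometry.dist_reflection_eq_of_mem _ (right_mem_affineSpan_pair ℝ a b) y

/-- A real sphere that is a singleton consists of its center. -/
theorem eq_of_sphere_eq_singleton {V : Type*} [NormedAddCommGroup V] [NormedSpace ℝ V]
    {a b : V} {r : ℝ} (h : Metric.sphere a r = {b}) : a = b := by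
  have hb : b ∈ Metric.sphere a r := h ▸ rfl
  have hb' : a + (a - b) ∈ Metric.sphere a r := by
    rw [mem_sphere_iff_norm] at hb ⊢
    rwa [add_sub_cancel_left, norm_sub_rev]
  rw [h, Set.mem_singleton_iff] at hb'
  have h₂ : (2 : ℝ) • (a - b) = 0 := by
    rw [two_smul]
    calc a - b + (a - b) = a + (a - b) - b := by abel
      _ = 0 := by rw [hb', sub_self]
  simpa [sub_eq_zero] using h₂


/-- **Lemma on collinearity.** Let `p ≥ 1` and let
`f, g : ℝ^p → ℝ^p` be injective maps with
`g(S(x, ‖x − y‖)) = S(f(x), ‖f(x) − g(y)‖)` for all `x, y`. If `x, x', x''` are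
pairwise distinct, `y, y', y''` are pairwise distinct, and all six points are
collinear, then `f x, f x', f x'', g y, g y', g y''` are collinear. -/
theorem sphere_preserving_pair_collinear
    (p : ℕ) (hp : 1 ≤ p)
    (f g : EuclideanSpace ℝ (Fin p) → EuclideanSpace ℝ (Fin p))
    (hf_inj : Function.Injective f) (hg_inj : Function.Injective g)
    (hsphere : ∀ x y : EuclideanSpace ℝ (Fin p),
      g '' Metric.sphere x ‖x - y‖ = Metric.sphere (f x) ‖f x - g y‖)
    (x x' x'' y y' y'' : EuclideanSpace ℝ (Fin p))
    (hx1 : x ≠ x') (hx2 : x ≠ x'') (hx3 : x' ≠ x'')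
    (hy1 : y ≠ y') (hy2 : y ≠ y'') (hy3 : y' ≠ y'')
    (hcol : Collinear ℝ ({x, x', x'', y, y', y''} : Set (EuclideanSpace ℝ (Fin p)))) :
    Collinear ℝ ({f x, f x', f x'', g y, g y', g y''} : Set (EuclideanSpace ℝ (Fin p))) := by
  have hfg : f = g := by
    funext a
    have h := hsphere a a
    rw [sub_self, norm_zero, Metric.sphere_zero, Set.image_singleton] at h
    exact eq_of_sphere_eq_singleton h.symm
  subst hfg
  have hnorm : ∀ a b c, ‖f a - f b‖ = ‖f a - f c‖ → ‖a - b‖ = ‖a - c‖ := by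
    intro a b c h
    have hb : f b ∈ Metric.sphere (f a) ‖f a - f c‖ := by
      rw [mem_sphere_iff_norm, norm_sub_rev, h]
    rw [← hsphere, hf_inj.mem_set_image, mem_sphere_iff_norm, norm_sub_rev] at hb
    exact hb
  have hmem : ∀ b ∈ line[ℝ, x, x'], f b ∈ line[ℝ, f x, f x'] := by
    intro b hb
    refine mem_line_of_forall_dist_eq fun z hz hz' => ?_
    have hz_image : z ∈ f '' Metric.sphere x ‖x - b‖ := by
      rw [hsphere, mem_sphere_iff_norm, norm_sub_rev, hz]
    obtain ⟨c, -, rfl⟩ := hz_image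
    rw [eq_of_mem_line_of_dist_eq hb (hnorm _ _ _ hz) (hnorm _ _ _ hz')]
  have hline : ∀ b ∈ ({x, x', x'', y, y', y''} : Set (EuclideanSpace ℝ (Fin p))),
      f b ∈ line[ℝ, f x, f x'] := fun b hb =>
    hmem b (hcol.mem_affineSpan_of_mem_of_ne (by simp) (by simp) hb hx1)
  rw [collinear_iff_of_mem (p₀ := f x) (by simp)]
  refine ⟨f x' - f x, fun q hq => ?_⟩
  obtain ⟨b, hb, rfl⟩ : q ∈ f '' {x, x', x'', y, y', y''} := by
    simpa [Set.image_insert_eq] using hq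
  obtain ⟨t, ht⟩ := mem_affineSpan_pair_iff_exists_lineMap_eq.1 (hline b hb)
  exact ⟨t, by rw [← ht, AffineMap.lineMap_apply, vsub_eq_sub]⟩
end

section
/- Let p ≥ 1, let B ⊆ ℝ^p be a non-empty open ball, and let f : B → ℝ^p and g : B → ℝ^p form an isotonic unfolding pair on (B, B). Then for every subset S ⊆ B, the affine dimension of f(S) equals the affine dimension of S, i.e., dim f(S) = dim S. -/
open Module in
/-- Adding a point outside the affine span of a nonempty set raises its affine dimension. -/
theorem finrank_vectorSpan_lt_finrank_vectorSpan_insert {V : Type*} [AddCommGroup V] [Module ℝ V]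
    [FiniteDimensional ℝ V] {T : Set V} (hT : T.Nonempty) {x : V} (hx : x ∉ affineSpan ℝ T) :
    finrank ℝ (vectorSpan ℝ T) < finrank ℝ (vectorSpan ℝ (insert x T)) := by
  rw [← direction_affineSpan, ← direction_affineSpan]
  refine Submodule.finrank_lt_finrank_of_lt (AffineSubspace.direction_lt_of_nonempty ?_ ?_)
  · refine lt_of_le_of_ne (affineSpan_mono ℝ (Set.subset_insert x T)) fun h => hx ?_
    rw [h]
    exact mem_affineSpan ℝ (Set.mem_insert x T)
  · exact (affineSpan_nonempty ℝ).2 hT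

section Unfolding

variable {E : Type*} [NormedAddCommGroup E] [InnerProductSpace ℝ E] [FiniteDimensional ℝ E]

open AffineSubspace InnerProductSpace

/-- A point outside the affine span of a set meeting the open set `B` is separated from it by a
perpendicular bisector of two points of `B`. -/
theorem exists_perpBisector_of_notMem_affineSpan {B T : Set E} (hB : IsOpen B) (hTB : T ⊆ B)
    (hT : T.Nonempty) {x : E} (hx : x ∉ affineSpan ℝ T) :
    ∃ y ∈ B, ∃ y' ∈ B, T ⊆ perpBisector y y' ∧ x ∉ perpBisector y y' := by
  obtain ⟨t, ht⟩ := hT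
  have htA := mem_affineSpan ℝ ht
  have hxt : x - t ∉ (affineSpan ℝ T).direction := fun h =>
    hx ((vsub_right_mem_direction_iff_mem htA x).1 h)
  obtain ⟨v, hv, hvx⟩ : ∃ v ∈ (affineSpan ℝ T).directionᗮ, inner ℝ v (x - t) ≠ 0 := by
    by_contra! h
    rw [← Submodule.orthogonal_orthogonal (affineSpan ℝ T).direction] at hxt
    exact hxt ((Submodule.mem_orthogonal _ _).2 h)
  have hnear : ∀ᶠ e : ℝ in nhdsWithin 0 {0}ᶜ, t + e • v ∈ B ∧ t - e • v ∈ B := by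
    refine Filter.Eventually.filter_mono nhdsWithin_le_nhds (Filter.Eventually.and ?_ ?_)
    · exact (by fun_prop : Continuous fun e : ℝ => t + e • v).continuousAt.eventually_mem
        (hB.mem_nhds (by simpa using hTB ht))
    · exact (by fun_prop : Continuous fun e : ℝ => t - e • v).continuousAt.eventually_mem
        (hB.mem_nhds (by simpa using hTB ht))
  obtain ⟨e, ⟨hy, hy'⟩, he⟩ := (hnear.and self_mem_nhdsWithin).exists
  have hmem (w : E) : w ∈ perpBisector (t + e • v) (t - e • v) ↔ inner ℝ v (w - t) = 0 := by
    rw [mem_perpBisector_iff_dist_eq, dist_eq_norm, dist_eq_norm,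
      show w - (t + e • v) = (w - t) - e • v by abel,
      show w - (t - e • v) = (w - t) + e • v by abel, eq_comm,
      InnerProductGeometry.norm_add_eq_norm_sub_iff_angle_eq_pi_div_two,
      ← InnerProductGeometry.inner_eq_zero_iff_angle_eq_pi_div_two, inner_smul_right, real_inner_comm]
    exact mul_eq_zero.trans (or_iff_right he)
  refine ⟨_, hy, _, hy', fun w hw => (hmem w).2 ?_, fun h => hvx ((hmem x).1 h)⟩
  exact (Submodule.mem_orthogonal' _ _).1 hv _ (vsub_mem_direction (mem_affineSpan ℝ hw) htA)

variable {B : Set E} {f g : E → E}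

/-- The first map of an isotonic unfolding pair keeps points outside affine spans. -/
theorem image_notMem_affineSpan_image (hB : IsOpen B)
    (hpair : ∀ x ∈ B, ∀ y ∈ B, ∀ y' ∈ B,
      (‖x - y‖ < ‖x - y'‖ ↔ ‖f x - g y‖ < ‖f x - g y'‖))
    {T : Set E} (hTB : T ⊆ B) {x : E} (hxB : x ∈ B) (hx : x ∉ affineSpan ℝ T) :
    f x ∉ affineSpan ℝ (f '' T) := by
  obtain rfl | hT := T.eq_empty_or_nonempty
  · simp [AffineSubspace.notMem_bot]
  obtain ⟨y, hy, y', hy', hsub, hxy⟩ := exists_perpBisector_of_notMem_affineSpan hB hTB hT hx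
  have hmem {w : E} (hw : w ∈ B) : f w ∈ perpBisector (g y) (g y') ↔ w ∈ perpBisector y y' := by
    simp only [mem_perpBisector_iff_dist_eq, dist_eq_norm]
    have h₁ := hpair w hw y hy y' hy'
    have h₂ := hpair w hw y' hy' y hy
    rw [le_antisymm_iff, le_antisymm_iff, ← not_lt, ← not_lt, ← not_lt, ← not_lt, h₁, h₂]
  have hle : affineSpan ℝ (f '' T) ≤ perpBisector (g y) (g y') := by
    rw [affineSpan_le]
    rintro _ ⟨w, hw, rfl⟩
    exact (hmem (hTB hw)).2 (hsub hw)
  exact fun h => hxy ((hmem hxB).1 (hle h))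

open Module

/-- A map keeping points outside affine spans does not lower affine dimension. -/
theorem finrank_vectorSpan_le_finrank_vectorSpan_image
    (hf : ∀ T ⊆ B, ∀ x ∈ B, x ∉ affineSpan ℝ T → f x ∉ affineSpan ℝ (f '' T))
    {S : Set E} (hS : S ⊆ B) :
    finrank ℝ (vectorSpan ℝ S) ≤ finrank ℝ (vectorSpan ℝ (f '' S)) := by
  obtain ⟨T, hTS, hspan, hT⟩ := exists_affineIndependent ℝ E S
  have hfin : T.Finite := finite_set_of_fin_dim_affineIndependent ℝ hT
  rw [← direction_affineSpan, ← hspan, direction_affineSpan]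
  refine le_trans ?_ (Submodule.finrank_mono (vectorSpan_mono ℝ (Set.image_mono hTS)))
  replace hTS := hTS.trans hS
  clear hspan hT hS
  induction T, hfin using Set.Finite.induction_on with
  | empty => rw [vectorSpan_empty, finrank_bot]; exact Nat.zero_le _
  | @insert x T _ _ ih =>
    obtain ⟨hxB, hTB⟩ := Set.insert_subset_iff.1 hTS
    obtain rfl | hne := T.eq_empty_or_nonempty
    · rw [insert_empty_eq, vectorSpan_singleton, finrank_bot]
      exact Nat.zero_le _
    by_cases hx : x ∈ affineSpan ℝ T
    · rw [← direction_affineSpan, affineSpan_insert_eq_affineSpan ℝ hx, direction_affineSpan]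
      exact (ih hTB).trans (Submodule.finrank_mono
        (vectorSpan_mono ℝ (Set.image_mono (Set.subset_insert x T))))
    · have := finrank_vectorSpan_insert_le_set ℝ T x
      have := finrank_vectorSpan_lt_finrank_vectorSpan_insert (hne.image f) (hf T hTB x hxB hx)
      have := ih hTB
      rw [Set.image_insert_eq]
      lia

/-- A map of a spanning set into the same space keeping points outside affine spans does not raise
affine dimension. -/
theorem finrank_vectorSpan_image_le_finrank_vectorSpan (hB : affineSpan ℝ B = ⊤)
    (hf : ∀ T ⊆ B, ∀ x ∈ B, x ∉ affineSpan ℝ T → f x ∉ affineSpan ℝ (f '' T))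
    {S : Set E} (hS : S ⊆ B) :
    finrank ℝ (vectorSpan ℝ (f '' S)) ≤ finrank ℝ (vectorSpan ℝ S) := by
  induction hn : finrank ℝ E - finrank ℝ (vectorSpan ℝ S) using Nat.strong_induction_on
    generalizing S with
  | _ n ih =>
    obtain rfl | hne := S.eq_empty_or_nonempty
    · rw [Set.image_empty]
    by_cases hBS : B ⊆ affineSpan ℝ S
    · have htop : affineSpan ℝ S = ⊤ := top_le_iff.1 (hB ▸ affineSpan_le.2 hBS)
      rw [← direction_affineSpan ℝ S, htop, direction_top, finrank_top]
      exact Submodule.finrank_le _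
    · obtain ⟨x, hxB, hx⟩ := Set.not_subset.1 hBS
      have hlt := finrank_vectorSpan_lt_finrank_vectorSpan_insert hne hx
      have hlt' := finrank_vectorSpan_lt_finrank_vectorSpan_insert (hne.image f) (hf S hS x hxB hx)
      have hle := finrank_vectorSpan_insert_le_set ℝ S x
      have hdim := Submodule.finrank_le (vectorSpan ℝ (insert x S))
      have := ih _ (by lia) (Set.insert_subset hxB hS) rfl
      rw [Set.image_insert_eq] at this
      lia

end Unfolding


/-- **Lemma: `f` preserves affine dimension.** Let `p ≥ 1`, let
`B ⊆ ℝ^p` be a non-empty open ball, and let `(f, g)` be an isotonic unfolding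
pair on `(B, B)`. Then `dim f(S) = dim S` for every `S ⊆ B`, where `dim`
denotes the dimension of the affine span. -/
theorem internal_unfolding_dim_image
    (p : ℕ) (hp : 1 ≤ p) (B : Set (EuclideanSpace ℝ (Fin p)))
    (hB : ∃ (z : EuclideanSpace ℝ (Fin p)) (r : ℝ), 0 < r ∧ B = Metric.ball z r)
    (f g : EuclideanSpace ℝ (Fin p) → EuclideanSpace ℝ (Fin p))
    (hf_inj : Set.InjOn f B) (hg_inj : Set.InjOn g B)
    (hpair : ∀ x ∈ B, ∀ y ∈ B, ∀ y' ∈ B,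
      (‖x - y‖ < ‖x - y'‖ ↔ ‖f x - g y‖ < ‖f x - g y'‖))
    (S : Set (EuclideanSpace ℝ (Fin p))) (hS : S ⊆ B) :
    Module.finrank ℝ (affineSpan ℝ (f '' S)).direction
      = Module.finrank ℝ (affineSpan ℝ S).direction := by
  obtain ⟨z, r, hr, rfl⟩ := hB
  have hf : ∀ T ⊆ Metric.ball z r, ∀ x ∈ Metric.ball z r, x ∉ affineSpan ℝ T →
      f x ∉ affineSpan ℝ (f '' T) := fun T hT x hx h =>
    image_notMem_affineSpan_image Metric.isOpen_ball hpair hT hx h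
  have htop := (Metric.isOpen_ball (x := z)).affineSpan_eq_top (Metric.nonempty_ball.2 hr)
  rw [direction_affineSpan, direction_affineSpan]
  exact le_antisymm (finrank_vectorSpan_image_le_finrank_vectorSpan htop hf hS)
    (finrank_vectorSpan_le_finrank_vectorSpan_image hf hS)
end

section
/- Let p ≥ 1, let B ⊆ ℝ^p be a non-empty open ball, and let f : B → ℝ^p and g : B → ℝ^p form an isotonic unfolding pair on (B, B). If y₁, y₂, y₃, y₄ ∈ B form a rectangle, in the sense that y₁ ≠ y₂, y₁ ≠ y₃, y₁ − y₂ = y₃ − y₄, and ⟨y₁ − y₂, y₁ − y₃⟩ = 0, then the image points form a rectangle in the same configuration: g(y₁) − g(y₂) = g(y₃) − g(y₄) and ⟨g(y₁) − g(y₂), g(y₁) − g(y₃)⟩ = 0. -/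
open scoped RealInnerProductSpace

section Biorthogonal

variable {E : Type*} [NormedAddCommGroup E] [InnerProductSpace ℝ E]

/-- If `m` lies on the bisector of `y` and `y'`, then `x` lies on it iff `x - m` is orthogonal
to `y - y'`. -/
theorem inner_sub_eq_zero_iff_norm_sub_eq {m x y y' : E} (hm : ‖m - y‖ = ‖m - y'‖) :
    ⟪y - y', x - m⟫ = 0 ↔ ‖x - y‖ = ‖x - y'‖ := by
  rw [← sq_eq_sq₀ (norm_nonneg _) (norm_nonneg _)] at hm ⊢
  simp only [norm_sub_sq_real, inner_sub_left, inner_sub_right] at hm ⊢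
  rw [real_inner_comm x y, real_inner_comm x y', real_inner_comm m y, real_inner_comm m y']
  constructor <;> intro h <;> linarith

/-- A family admitting a biorthogonal family (up to nonzero factors) is linearly independent. -/
theorem linearIndependent_of_inner_eq_zero_iff {ι : Type*} {n w : ι → E}
    (h : ∀ i j, ⟪n i, w j⟫ = 0 ↔ i ≠ j) : LinearIndependent ℝ w := by
  rw [linearIndependent_iff']
  intro s c hc i hi
  have h0 : ⟪n i, ∑ j ∈ s, c j • w j⟫ = 0 := by rw [hc, inner_zero_right]
  rw [inner_sum, Finset.sum_eq_single_of_mem i hi, inner_smul_right] at h0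
  · exact (mul_eq_zero.mp h0).resolve_right fun hz => (h i i).mp hz rfl
  · intro j _ hji
    rw [inner_smul_right, (h i j).mpr hji.symm, mul_zero]

/-- Two orthogonal nonzero vectors lie along an orthonormal basis, so every vector of that basis
is orthogonal to one of them. -/
theorem exists_orthonormalBasis_inner_eq_zero_or [FiniteDimensional ℝ E] {u v : E}
    (hu : u ≠ 0) (hv : v ≠ 0) (huv : ⟪u, v⟫ = 0) :
    ∃ (s : Finset E) (b : OrthonormalBasis s ℝ E), ∀ i, ⟪u, b i⟫ = 0 ∨ ⟪v, b i⟫ = 0 := by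
  have hu' : ‖u‖ ≠ 0 := norm_ne_zero_iff.mpr hu
  have hv' : ‖v‖ ≠ 0 := norm_ne_zero_iff.mpr hv
  have horth : Orthonormal ℝ
      ((↑) : ({‖u‖⁻¹ • u, ‖v‖⁻¹ • v} : Set E) → E) := by
    constructor
    · rintro ⟨x, rfl | rfl⟩ <;> simp [norm_smul, hu', hv']
    · rintro ⟨x, rfl | rfl⟩ ⟨y, rfl | rfl⟩ hxy
      · exact absurd rfl hxy
      · simp [inner_smul_left, inner_smul_right, huv]
      · simp [inner_smul_left, inner_smul_right, real_inner_comm, huv]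
      · exact absurd rfl hxy
  obtain ⟨s, b, hs, hb⟩ := horth.exists_orthonormalBasis_extension
  let i₀ : s := ⟨_, hs (Set.mem_insert _ _)⟩
  let i₁ : s := ⟨_, hs (Set.mem_insert_of_mem _ rfl)⟩
  have hi₀ : u = ‖u‖ • b i₀ := by simp [hb, i₀, smul_smul, hu']
  have hi₁ : v = ‖v‖ • b i₁ := by simp [hb, i₁, smul_smul, hv']
  have hne : i₀ ≠ i₁ := by
    intro h
    rw [hi₀, hi₁, h, inner_smul_left, inner_smul_right] at huv
    simp [hu', hv'] at huv
  refine ⟨s, b, fun i => ?_⟩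
  by_cases hi : i₀ = i
  · right
    rw [hi₁, inner_smul_left, b.orthonormal.2 (hi ▸ hne.symm), mul_zero]
  · left
    rw [hi₀, inner_smul_left, b.orthonormal.2 hi, mul_zero]

/-- A parallelogram inscribed in a sphere is a rectangle. -/
theorem inner_eq_zero_of_parallelogram_of_norm_sub_eq {a b c d o : E} (hpar : a - b = c - d)
    (hb : ‖o - a‖ = ‖o - b‖) (hc : ‖o - a‖ = ‖o - c‖) (hd : ‖o - a‖ = ‖o - d‖) :
    ⟪a - b, a - c⟫ = 0 := by
  have hd' : o - d = (o - c) + (a - b) := by rw [hpar]; abel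
  have hc' : o - c = (o - a) + (a - c) := by abel
  have hb' : o - b = (o - a) + (a - b) := by abel
  rw [hd', ← sq_eq_sq₀ (norm_nonneg _) (norm_nonneg _), norm_add_sq_real, ← hc, hc',
    inner_add_left, real_inner_comm (a - b) (a - c)] at hd
  rw [hb', ← sq_eq_sq₀ (norm_nonneg _) (norm_nonneg _), norm_add_sq_real] at hb
  have := real_inner_comm (a - b) (a - c)
  linarith

end Biorthogonal

/-- **Lemma: `g` preserves rectangles.** Let `p ≥ 1`, let
`B ⊆ ℝ^p` be a non-empty open ball, and let `(f, g)` be an isotonic unfolding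
pair on `(B, B)`. If `y₁, y₂, y₃, y₄ ∈ B` form a rectangle, then so do their
images under `g`, in the same configuration. -/
theorem internal_unfolding_rectangle
    (p : ℕ) (hp : 1 ≤ p) (B : Set (EuclideanSpace ℝ (Fin p)))
    (hB : ∃ (z : EuclideanSpace ℝ (Fin p)) (r : ℝ), 0 < r ∧ B = Metric.ball z r)
    (f g : EuclideanSpace ℝ (Fin p) → EuclideanSpace ℝ (Fin p))
    (hf_inj : Set.InjOn f B) (hg_inj : Set.InjOn g B)
    (hpair : ∀ x ∈ B, ∀ y ∈ B, ∀ y' ∈ B,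
      (‖x - y‖ < ‖x - y'‖ ↔ ‖f x - g y‖ < ‖f x - g y'‖))
    (y₁ y₂ y₃ y₄ : EuclideanSpace ℝ (Fin p))
    (h₁ : y₁ ∈ B) (h₂ : y₂ ∈ B) (h₃ : y₃ ∈ B) (h₄ : y₄ ∈ B)
    (hne12 : y₁ ≠ y₂) (hne13 : y₁ ≠ y₃)
    (hpar : y₁ - y₂ = y₃ - y₄)
    (hperp : ⟪y₁ - y₂, y₁ - y₃⟫ = 0) :
    g y₁ - g y₂ = g y₃ - g y₄ ∧ ⟪g y₁ - g y₂, g y₁ - g y₃⟫ = 0 := by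
  obtain ⟨z, r, -, rfl⟩ := hB
  have heq : ∀ x ∈ Metric.ball z r, ∀ y ∈ Metric.ball z r, ∀ y' ∈ Metric.ball z r,
      (‖x - y‖ = ‖x - y'‖ ↔ ‖f x - g y‖ = ‖f x - g y'‖) := by
    intro x hx y hy y' hy'
    have h := hpair x hx y hy y' hy'
    have h' := hpair x hx y' hy' y hy
    rw [le_antisymm_iff, le_antisymm_iff, ← not_lt, ← not_lt, ← not_lt, ← not_lt, h, h']
  have key : ∀ m ∈ Metric.ball z r, ∀ x ∈ Metric.ball z r, ∀ y ∈ Metric.ball z r,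
      ∀ y' ∈ Metric.ball z r, ‖m - y‖ = ‖m - y'‖ →
      (⟪y - y', x - m⟫ = 0 ↔ ⟪g y - g y', f x - f m⟫ = 0) := by
    intro m hm x hx y hy y' hy' h
    rw [inner_sub_eq_zero_iff_norm_sub_eq h,
      inner_sub_eq_zero_iff_norm_sub_eq ((heq m hm y hy y' hy').mp h), heq x hx y hy y' hy']
  obtain ⟨s, b, hb⟩ := exists_orthonormalBasis_inner_eq_zero_or
    (sub_ne_zero.mpr hne12) (sub_ne_zero.mpr hne13) hperp
  set m := midpoint ℝ y₁ y₄ with hm_def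
  have hm : m ∈ Metric.ball z r := (convex_ball z r).midpoint_mem h₁ h₄
  have hpar' : y₁ - y₃ = y₂ - y₄ := by
    rw [sub_eq_sub_iff_add_eq_add] at hpar ⊢
    rw [hpar, add_comm]
  have hm₁ : m - y₁ = (-1 / 2 : ℝ) • ((y₁ - y₂) + (y₁ - y₃)) := by
    rw [hpar', hm_def, midpoint_eq_smul_add, invOf_eq_inv]; module
  have hm₂ : m - y₂ = (1 / 2 : ℝ) • ((y₁ - y₂) - (y₁ - y₃)) := by
    rw [hpar', hm_def, midpoint_eq_smul_add, invOf_eq_inv]; module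
  have hm₃ : m - y₃ = (-1 / 2 : ℝ) • ((y₁ - y₂) - (y₁ - y₃)) := by
    have : m - y₃ = (m - y₁) + (y₁ - y₃) := by abel
    rw [this, hm₁]; module
  have hm₄ : m - y₄ = (1 / 2 : ℝ) • ((y₁ - y₂) + (y₁ - y₃)) := by
    rw [hpar', hm_def, midpoint_eq_smul_add, invOf_eq_inv]; module
  have hdiag : ‖(y₁ - y₂) + (y₁ - y₃)‖ = ‖(y₁ - y₂) - (y₁ - y₃)‖ :=
    (norm_sub_eq_norm_add (by rw [real_inner_comm, hperp])).symm
  have hm12 : ‖m - y₁‖ = ‖m - y₂‖ := by rw [hm₁, hm₂, norm_smul, norm_smul, hdiag]; norm_num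
  have hm13 : ‖m - y₁‖ = ‖m - y₃‖ := by rw [hm₁, hm₃, norm_smul, norm_smul, hdiag]
  have hm14 : ‖m - y₁‖ = ‖m - y₄‖ := by rw [hm₁, hm₄, norm_smul, norm_smul]; norm_num
  obtain ⟨ε, hε, hball⟩ := Metric.isOpen_iff.mp Metric.isOpen_ball m hm
  have hmem : ∀ i, ∀ t : ℝ, |t| < ε → m + t • b i ∈ Metric.ball z r := by
    intro i t ht
    apply hball
    simpa [norm_smul] using ht
  have hδ : |ε / 2| < ε := by rw [abs_of_pos (half_pos hε)]; exact half_lt_self hε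
  have hδ' : |-(ε / 2)| < ε := by rwa [abs_neg]
  set x : s → EuclideanSpace ℝ (Fin p) := fun i => m + (ε / 2) • b i with hx_def
  have hx : ∀ i, x i ∈ Metric.ball z r := fun i => hmem i _ hδ
  have hxm : ∀ i, x i - m = (ε / 2) • b i := fun i => add_sub_cancel_left _ _
  have hw : LinearIndependent ℝ fun i => f (x i) - f m := by
    refine linearIndependent_of_inner_eq_zero_iff
      (n := fun i => g (x i) - g (m + (-(ε / 2)) • b i)) fun i j => ?_
    rw [← key m hm _ (hx j) _ (hx i) _ (hmem i _ hδ') (by simp [hx_def, norm_smul]), hxm]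
    have : x i - (m + (-(ε / 2)) • b i) = ε • b i := by simp only [hx_def]; module
    rw [this, inner_smul_left, inner_smul_right, b.inner_eq_ite]
    simp [hε.ne']
  have hspan : Submodule.span ℝ (Set.range fun i => f (x i) - f m) = ⊤ :=
    hw.span_eq_top_of_card_eq_finrank' (Module.finrank_eq_card_basis b.toBasis).symm
  have hgpar : g y₁ - g y₂ = g y₃ - g y₄ := by
    refine InnerProductSpace.ext_inner_left_basis (𝕜 := ℝ) (Module.Basis.mk hw hspan.ge) fun i => ?_
    rw [Module.Basis.mk_apply, real_inner_comm, real_inner_comm (g y₃ - g y₄), ← sub_eq_zero,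
      ← inner_sub_left]
    rcases hb i with h | h
    · have hz : ⟪y₁ - y₂, x i - m⟫ = 0 := by rw [hxm, inner_smul_right, h, mul_zero]
      rw [inner_sub_left, (key m hm _ (hx i) _ h₁ _ h₂ hm12).mp hz,
        (key m hm _ (hx i) _ h₃ _ h₄ (hm13.symm.trans hm14)).mp (hpar ▸ hz), sub_zero]
    · have hz : ⟪y₁ - y₃, x i - m⟫ = 0 := by rw [hxm, inner_smul_right, h, mul_zero]
      rw [sub_sub_sub_comm, inner_sub_left, (key m hm _ (hx i) _ h₁ _ h₃ hm13).mp hz,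
        (key m hm _ (hx i) _ h₂ _ h₄ (hm12.symm.trans hm14)).mp (hpar' ▸ hz), sub_zero]
  exact ⟨hgpar, inner_eq_zero_of_parallelogram_of_norm_sub_eq hgpar
    ((heq m hm _ h₁ _ h₂).mp hm12) ((heq m hm _ h₁ _ h₃).mp hm13)
    ((heq m hm _ h₁ _ h₄).mp hm14)⟩
end

section
/- Let p ≥ 1, let B ⊆ ℝ^p be a non-empty open ball, and let f : B → ℝ^p and g : B → ℝ^p form an isotonic unfolding pair on (B, B). Then the image g(B) has affine dimension p, i.e., the affine span of g(B) is all of ℝ^p. -/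
open scoped RealInnerProductSpace

/-- A point is closer to `a` than to `b` exactly when it lies in an open half-space with
normal vector `b - a`. -/
lemma norm_sub_lt_norm_sub_iff_inner_lt {E : Type*} [NormedAddCommGroup E]
    [InnerProductSpace ℝ E] (u a b : E) :
    ‖u - a‖ < ‖u - b‖ ↔ ⟪b - a, u⟫ < (‖b‖ ^ 2 - ‖a‖ ^ 2) / 2 := by
  rw [← sq_lt_sq₀ (norm_nonneg _) (norm_nonneg _), norm_sub_sq_real, norm_sub_sq_real,
    inner_sub_left, real_inner_comm u a, real_inner_comm u b]
  constructor <;> intro h <;> linarith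

/-- Points closer to `m + w` than to `m - w` are those on the positive side of the hyperplane
through `m` with normal vector `w`. -/
lemma norm_sub_add_lt_norm_sub_sub_iff_inner_pos {E : Type*} [NormedAddCommGroup E]
    [InnerProductSpace ℝ E] (u m w : E) :
    ‖u - (m + w)‖ < ‖u - (m - w)‖ ↔ 0 < ⟪w, u - m⟫ := by
  rw [← sq_lt_sq₀ (norm_nonneg _) (norm_nonneg _), show u - (m + w) = (u - m) - w by abel,
    show u - (m - w) = (u - m) + w by abel, norm_sub_sq_real, norm_add_sq_real,
    real_inner_comm (u - m) w]
  constructor <;> intro h <;> linarith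

/-- Every hyperplane meeting a ball is the perpendicular bisector of two points of the ball. -/
lemma exists_mem_ball_bisector {E : Type*} [NormedAddCommGroup E] [InnerProductSpace ℝ E]
    {z m : E} {r : ℝ} (hm : m ∈ Metric.ball z r) (w : E) :
    ∃ y ∈ Metric.ball z r, ∃ y' ∈ Metric.ball z r, ∀ u,
      (0 < ⟪w, u - m⟫ → ‖u - y‖ < ‖u - y'‖) ∧ (⟪w, u - m⟫ < 0 → ‖u - y'‖ < ‖u - y‖) := by
  obtain ⟨δ, hδ, hball⟩ := Metric.isOpen_iff.1 Metric.isOpen_ball m hm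
  have hw : 0 < ‖w‖ + 1 := by positivity
  set t : ℝ := δ / (‖w‖ + 1) with ht_def
  have ht : 0 < t := div_pos hδ hw
  have htw : ‖t • w‖ < δ := by
    rw [norm_smul, Real.norm_of_nonneg ht.le, ht_def, div_mul_eq_mul_div, div_lt_iff₀ hw]
    nlinarith
  refine ⟨m + t • w, hball (by simpa using htw), m - t • w, hball (by simpa using htw),
    fun u => ⟨fun h => ?_, fun h => ?_⟩⟩
  · rw [norm_sub_add_lt_norm_sub_sub_iff_inner_pos, real_inner_smul_left]
    exact mul_pos ht h
  · have := norm_sub_add_lt_norm_sub_sub_iff_inner_pos u m (-(t • w))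
    rw [← sub_eq_add_neg, sub_neg_eq_add] at this
    rw [this, inner_neg_left, real_inner_smul_left]
    nlinarith

/-- Every non-empty open ball of `ℝ^p` contains `p + 1` points such that each bipartition of them
is realised by comparing distances to two points of the ball. -/
lemma exists_shattered_family_in_ball {p : ℕ} (hp : 1 ≤ p) (z : EuclideanSpace ℝ (Fin p))
    {r : ℝ} (hr : 0 < r) :
    ∃ x : Option (Fin p) → EuclideanSpace ℝ (Fin p), (∀ i, x i ∈ Metric.ball z r) ∧
      ∀ I : Set (Option (Fin p)), ∃ y ∈ Metric.ball z r, ∃ y' ∈ Metric.ball z r,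
        (∀ i ∈ I, ‖x i - y‖ < ‖x i - y'‖) ∧ (∀ i ∈ Iᶜ, ‖x i - y'‖ < ‖x i - y‖) := by
  classical
  refine ⟨fun i => i.elim z fun k => z + EuclideanSpace.single k (r / 2), ?_, fun I => ?_⟩
  · rintro (_ | k)
    · simpa using hr
    · simp [abs_of_pos hr, hr]
  let σ : Option (Fin p) → ℝ := fun i => if i ∈ I then 1 else -1
  have hσ : ∀ i, σ i = 1 ∨ σ i = -1 := fun i => by
    by_cases h : i ∈ I <;> simp [σ, h]
  let w : EuclideanSpace ℝ (Fin p) := WithLp.toLp 2 fun k => 2 * σ (some k)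
  let j : Fin p := ⟨0, hp⟩
  let m := z - EuclideanSpace.single j (r / 2 * (σ none * σ (some j) / 2))
  have hm : m ∈ Metric.ball z r := by
    rw [mem_ball_iff_norm]
    simp only [m, sub_sub_cancel_left, norm_neg, PiLp.norm_single, Real.norm_eq_abs]
    rw [abs_lt]
    rcases hσ none with h | h <;> rcases hσ (some j) with h' | h' <;> rw [h, h'] <;>
      constructor <;> linarith
  have hz : ⟪w, z - m⟫ = r / 2 * σ none := by
    simp only [m, sub_sub_cancel, EuclideanSpace.inner_single_right, w]
    rcases hσ (some j) with h | h <;> simp [h] <;> ring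
  have hk : ∀ k, ⟪w, z + EuclideanSpace.single k (r / 2) - m⟫
      = r / 2 * (2 * σ (some k) + σ none) := fun k => by
    rw [add_sub_right_comm, inner_add_right, hz, EuclideanSpace.inner_single_right]
    simp [w]
    ring
  obtain ⟨y, hy, y', hy', h⟩ := exists_mem_ball_bisector hm w
  refine ⟨y, hy, y', hy', fun i hi => (h _).1 ?_, fun i hi => (h _).2 ?_⟩
  · have hi1 : σ i = 1 := if_pos hi
    rcases i with _ | k
    · simp only [Option.elim_none, hz, hi1]; linarith
    · simp only [Option.elim_some, hk, hi1]
      rcases hσ none with h0 | h0 <;> rw [h0] <;> linarith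
  · have hi1 : σ i = -1 := if_neg hi
    rcases i with _ | k
    · simp only [Option.elim_none, hz, hi1]; linarith
    · simp only [Option.elim_some, hk, hi1]
      rcases hσ none with h0 | h0 <;> rw [h0] <;> linarith

/-- A family with more than `finrank V + 1` members in a space of dimension `finrank V` has a
bipartition not strictly separated by any hyperplane. -/
lemma exists_bipartition_not_separated {ι V : Type*} [Fintype ι] [NormedAddCommGroup V]
    [InnerProductSpace ℝ V] [FiniteDimensional ℝ V] (u : ι → V)
    (hcard : Module.finrank ℝ V + 1 < Fintype.card ι) :
    ∃ I : Set ι, ∀ (v : V) (c : ℝ),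
      (∀ i ∈ I, ⟪v, u i⟫ < c) → ¬ ∀ i ∈ Iᶜ, c < ⟪v, u i⟫ := by
  have hdep : ¬ AffineIndependent ℝ u := fun h =>
    absurd (h.card_le_finrank_succ.trans
      (Nat.succ_le_succ (Submodule.finrank_le _))) (not_le.2 hcard)
  obtain ⟨I, q, hq, hq'⟩ := Convex.radon_partition hdep
  refine ⟨I, fun v c h h' => ?_⟩
  have hlin : IsLinearMap ℝ fun a : V => ⟪v, a⟫ := (innerₛₗ ℝ v).isLinear
  have h1 : q ∈ {a : V | ⟪v, a⟫ < c} :=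
    convexHull_min (Set.forall_mem_image.2 h : u '' I ⊆ {a : V | ⟪v, a⟫ < c})
      (convex_halfSpace_lt hlin c) hq
  have h2 : q ∈ {a : V | c < ⟪v, a⟫} :=
    convexHull_min (Set.forall_mem_image.2 h' : u '' Iᶜ ⊆ {a : V | c < ⟪v, a⟫})
      (convex_halfSpace_gt hlin c) hq'
  exact lt_asymm (Set.mem_ofPred.1 h1) (Set.mem_ofPred.1 h2)

/-- **Corollary: `g(B)` is full-dimensional.** Let `p ≥ 1`, let
`B ⊆ ℝ^p` be a non-empty open ball, and let `(f, g)` be an isotonic unfolding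
pair on `(B, B)`. Then the affine span of `g(B)` is all of `ℝ^p`. -/
theorem internal_unfolding_image_full_dim
    (p : ℕ) (hp : 1 ≤ p) (B : Set (EuclideanSpace ℝ (Fin p)))
    (hB : ∃ (z : EuclideanSpace ℝ (Fin p)) (r : ℝ), 0 < r ∧ B = Metric.ball z r)
    (f g : EuclideanSpace ℝ (Fin p) → EuclideanSpace ℝ (Fin p))
    (hf_inj : Set.InjOn f B) (hg_inj : Set.InjOn g B)
    (hpair : ∀ x ∈ B, ∀ y ∈ B, ∀ y' ∈ B,
      (‖x - y‖ < ‖x - y'‖ ↔ ‖f x - g y‖ < ‖f x - g y'‖)) :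
    affineSpan ℝ (g '' B) = ⊤ := by
  obtain ⟨z, r, hr, rfl⟩ := hB
  by_contra hspan
  obtain ⟨x, hx, hshatter⟩ := exists_shattered_family_in_ball hp z hr
  let V := vectorSpan ℝ (g '' Metric.ball z r)
  have hne : (affineSpan ℝ (g '' Metric.ball z r) :
      Set (EuclideanSpace ℝ (Fin p))).Nonempty :=
    ((Metric.nonempty_ball.2 hr).image g).affineSpan ℝ
  have hV : V ≠ ⊤ := fun h => hspan <| by
    rwa [← AffineSubspace.direction_eq_top_iff_of_nonempty hne, direction_affineSpan]
  have hfin : Module.finrank ℝ V < p := by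
    simpa using Submodule.finrank_lt hV
  obtain ⟨I, hI⟩ := exists_bipartition_not_separated
    (fun i => V.orthogonalProjectionOnto (f (x i))) (by simpa using hfin)
  obtain ⟨y, hy, y', hy', hlt, hgt⟩ := hshatter I
  have hv : g y' - g y ∈ V :=
    vsub_mem_vectorSpan ℝ (Set.mem_image_of_mem g hy') (Set.mem_image_of_mem g hy)
  have hproj : ∀ a, ⟪(⟨g y' - g y, hv⟩ : V), V.orthogonalProjectionOnto a⟫ = ⟪g y' - g y, a⟫ :=
    fun a => Submodule.inner_orthogonalProjectionOnto_eq_of_mem_left ⟨g y' - g y, hv⟩ a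
  refine hI ⟨g y' - g y, hv⟩ ((‖g y'‖ ^ 2 - ‖g y‖ ^ 2) / 2) (fun i hi => ?_) fun i hi => ?_
  · rw [hproj, ← norm_sub_lt_norm_sub_iff_inner_lt]
    exact (hpair _ (hx i) _ hy _ hy').1 (hlt i hi)
  · have h := (norm_sub_lt_norm_sub_iff_inner_lt _ _ _).1
      ((hpair _ (hx i) _ hy' _ hy).1 (hgt i hi))
    rw [← neg_sub (g y') (g y), inner_neg_left] at h
    rw [hproj]
    linarith
end

section
/- Let p ≥ 1, let B ⊆ ℝ^p be a non-empty open ball, and let f : B → ℝ^p and g : B → ℝ^p form an isotonic unfolding pair on (B, B). Then: (i) for any y₁, y₂, y₃ ∈ B lying on a common affine line, the points g(y₁), g(y₂), g(y₃) lie on a common affine line; and (ii) for any y₁, y₂, y₃, y₄ ∈ B with y₁ ≠ y₂, y₃ ≠ y₄, and y₂ − y₁ = c·(y₄ − y₃) for some scalar c ∈ ℝ, there exists a scalar c' ∈ ℝ with g(y₂) − g(y₁) = c'·(g(y₄) − g(y₃)). -/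
open scoped RealInnerProductSpace

set_option linter.unusedSectionVars false

section UnfoldingPair

variable {E ι : Type*} [NormedAddCommGroup E] [InnerProductSpace ℝ E]

/-- In a finite-dimensional space, a vector orthogonal to all but the `k`-th member of one of two
biorthogonal families of full cardinality is a multiple of the `k`-th member of the other. -/
lemma exists_eq_smul_of_biorthogonal [Fintype ι] [FiniteDimensional ℝ E]
    (hcard : Fintype.card ι = Module.finrank ℝ E) {u w : ι → E}
    (hne : ∀ i, ⟪u i, w i⟫ ≠ 0) (horth : ∀ i j, i ≠ j → ⟪u i, w j⟫ = 0)
    {k : ι} {v : E} (hv : ∀ i, i ≠ k → ⟪u i, v⟫ = 0) : ∃ c : ℝ, v = c • w k := by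
  classical
  have hli : LinearIndependent ℝ u := by
    rw [Fintype.linearIndependent_iff]
    intro a ha i
    have h : ⟪∑ j, a j • u j, w i⟫ = 0 := by rw [ha, inner_zero_left]
    rw [sum_inner, Finset.sum_eq_single i] at h
    · rw [real_inner_smul_left] at h
      exact (mul_eq_zero.mp h).resolve_right (hne i)
    · intro j _ hj
      rw [real_inner_smul_left, horth j i hj, mul_zero]
    · simp
  have hspan := hli.span_eq_top_of_card_eq_finrank' hcard
  refine ⟨⟪u k, v⟫ / ⟪u k, w k⟫, ?_⟩
  rw [← sub_eq_zero]
  set d := v - (⟪u k, v⟫ / ⟪u k, w k⟫) • w k with hd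
  have hud : ∀ i, ⟪u i, d⟫ = 0 := by
    intro i
    rw [hd, inner_sub_right, real_inner_smul_right]
    by_cases hi : i = k
    · subst hi
      field_simp [hne i]
      ring
    · rw [hv i hi, horth i k hi]
      ring
  have hmem : d ∈ Submodule.span ℝ (Set.range u) := by rw [hspan]; trivial
  have hdd : ∀ x ∈ Submodule.span ℝ (Set.range u), ⟪x, d⟫ = 0 := by
    intro x hx
    induction hx using Submodule.span_induction with
    | mem x hx => obtain ⟨i, rfl⟩ := hx; exact hud i
    | zero => exact inner_zero_left _
    | add x y _ _ hx hy => rw [inner_add_left, hx, hy, add_zero]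
    | smul a x _ hx => rw [real_inner_smul_left, hx, mul_zero]
  exact inner_self_eq_zero.mp (hdd d hmem)

lemma norm_sub_sq_sub_norm_sub_sq (x x' y y' : E) :
    (‖x - y‖ ^ 2 - ‖x - y'‖ ^ 2) - (‖x' - y‖ ^ 2 - ‖x' - y'‖ ^ 2) =
      2 * ⟪x' - x, y - y'⟫ := by
  simp only [norm_sub_sq_real, inner_sub_left, inner_sub_right]
  ring

lemma norm_sub_eq_norm_sub_iff (x y y' : E) :
    ‖x - y‖ = ‖x - y'‖ ↔ 2 * ⟪x, y - y'⟫ = ‖y‖ ^ 2 - ‖y'‖ ^ 2 := by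
  rw [← sq_eq_sq₀ (norm_nonneg _) (norm_nonneg _), norm_sub_sq_real, norm_sub_sq_real,
    inner_sub_right]
  constructor <;> intro h <;> linarith

/-- The points of `B` equidistant from two points stay equidistant after moving orthogonally to
the segment joining these. -/
lemma norm_add_sub_eq_of_inner_eq_zero {x v y y' : E} (h : ‖x - y‖ = ‖x - y'‖)
    (hv : ⟪v, y - y'⟫ = 0) : ‖x + v - y‖ = ‖x + v - y'‖ := by
  rw [norm_sub_eq_norm_sub_iff] at h ⊢
  rw [inner_add_left, hv, add_zero, h]

/-- An isotonic unfolding pair on `(B, B)` (only the injectivity of `g` is recorded). -/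
structure IsotonicPairOn (B : Set E) (f g : E → E) : Prop where
  injOn : Set.InjOn g B
  lt_iff : ∀ x ∈ B, ∀ y ∈ B, ∀ y' ∈ B,
    (‖x - y‖ < ‖x - y'‖ ↔ ‖f x - g y‖ < ‖f x - g y'‖)

/-- The displacement of `g` along a segment centred at `q` in the direction `e`. -/
def centralDiff (g : E → E) (q e : E) : E := g (q + e) - g (q - e)

namespace IsotonicPairOn

variable {B : Set E} {f g : E → E}

lemma norm_eq (h : IsotonicPairOn B f g) {x y y' : E} (hx : x ∈ B) (hy : y ∈ B) (hy' : y' ∈ B)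
    (he : ‖x - y‖ = ‖x - y'‖) : ‖f x - g y‖ = ‖f x - g y'‖ := by
  have h1 := (h.lt_iff x hx y hy y' hy').not
  have h2 := (h.lt_iff x hx y' hy' y hy).not
  exact le_antisymm (not_lt.mp (h2.mp he.not_gt.elim)) (not_lt.mp (h1.mp he.not_lt))

lemma inner_eq_zero (h : IsotonicPairOn B f g) {x x' y y' : E} (hx : x ∈ B) (hx' : x' ∈ B)
    (hy : y ∈ B) (hy' : y' ∈ B) (he : ‖x - y‖ = ‖x - y'‖) (he' : ‖x' - y‖ = ‖x' - y'‖) :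
    ⟪f x' - f x, g y - g y'⟫ = 0 := by
  have h1 := norm_sub_sq_sub_norm_sub_sq (f x) (f x') (g y) (g y')
  rw [h.norm_eq hx hy hy' he, h.norm_eq hx' hy hy' he'] at h1
  linarith

lemma inner_ne_zero (h : IsotonicPairOn B f g) {x x' y y' : E} (hx : x ∈ B) (hx' : x' ∈ B)
    (hy : y ∈ B) (hy' : y' ∈ B) (he : ‖x - y‖ = ‖x - y'‖) (hlt : ‖x' - y‖ < ‖x' - y'‖) :
    ⟪f x' - f x, g y - g y'⟫ ≠ 0 := by
  have h1 := norm_sub_sq_sub_norm_sub_sq (f x) (f x') (g y) (g y')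
  rw [h.norm_eq hx hy hy' he] at h1
  have h2 := pow_lt_pow_left₀ ((h.lt_iff x' hx' y hy y' hy').mp hlt) (norm_nonneg _) two_ne_zero
  intro h0
  rw [h0] at h1
  linarith

variable [Fintype ι] (b : OrthonormalBasis ι ℝ E) {q : E} {ε : ℝ}

lemma inner_basis_of_ne {i j : ι} (hij : i ≠ j) : ⟪b i, b j⟫ = 0 := b.orthonormal.2 hij

lemma norm_smul_basis (hε : 0 < ε) (i : ι) : ‖ε • b i‖ = ε := by
  rw [norm_smul, b.norm_eq_one, mul_one, Real.norm_of_nonneg hε.le]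

lemma add_mem_of_norm_le (hsub : Metric.closedBall q (2 * ε) ⊆ B) {v : E} (hv : ‖v‖ ≤ 2 * ε) :
    q + v ∈ B :=
  hsub (by rw [Metric.mem_closedBall, dist_eq_norm, add_sub_cancel_left]; exact hv)

lemma add_smul_mem (hε : 0 < ε) (hsub : Metric.closedBall q (2 * ε) ⊆ B) (i : ι) :
    q + ε • b i ∈ B :=
  add_mem_of_norm_le hsub (by rw [norm_smul_basis b hε]; linarith)

lemma sub_smul_mem (hε : 0 < ε) (hsub : Metric.closedBall q (2 * ε) ⊆ B) (i : ι) :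
    q - ε • b i ∈ B := by
  rw [sub_eq_add_neg]
  exact add_mem_of_norm_le hsub (by rw [norm_neg, norm_smul_basis b hε]; linarith)

lemma norm_sub_add_eq (q e : E) : ‖q - (q + e)‖ = ‖q - (q - e)‖ := by
  simp

lemma centralDiff_ne_zero (h : IsotonicPairOn B f g) (hε : 0 < ε)
    (hsub : Metric.closedBall q (2 * ε) ⊆ B) (i : ι) : centralDiff g q (ε • b i) ≠ 0 := by
  intro h0
  have h1 := h.injOn (add_smul_mem b hε hsub i) (sub_smul_mem b hε hsub i) (sub_eq_zero.mp h0)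
  have h2 : (2 * ε) • b i = 0 := by
    rw [mul_smul, two_smul]
    have := sub_eq_zero.mpr h1
    rwa [add_sub_sub_cancel] at this
  rcases smul_eq_zero.mp h2 with h3 | h3
  · linarith
  · exact b.orthonormal.ne_zero i h3

lemma mem_of_closedBall_subset (hε : 0 < ε) (hsub : Metric.closedBall q (2 * ε) ⊆ B) : q ∈ B :=
  hsub (Metric.mem_closedBall_self (by linarith))

lemma inner_sub_centralDiff_ne_zero (h : IsotonicPairOn B f g) (hε : 0 < ε)
    (hsub : Metric.closedBall q (2 * ε) ⊆ B) (i : ι) :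
    ⟪f (q + ε • b i) - f q, centralDiff g q (ε • b i)⟫ ≠ 0 := by
  refine h.inner_ne_zero (mem_of_closedBall_subset hε hsub) (add_smul_mem b hε hsub i)
    (add_smul_mem b hε hsub i) (sub_smul_mem b hε hsub i) (norm_sub_add_eq _ _) ?_
  rw [sub_self, norm_zero, add_sub_sub_cancel, ← two_smul ℝ, norm_smul, norm_smul_basis b hε]
  exact mul_pos (by norm_num) hε

lemma inner_sub_centralDiff_eq_zero (h : IsotonicPairOn B f g) (hε : 0 < ε)
    (hsub : Metric.closedBall q (2 * ε) ⊆ B) {i j : ι} (hij : i ≠ j) :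
    ⟪f (q + ε • b i) - f q, centralDiff g q (ε • b j)⟫ = 0 := by
  refine h.inner_eq_zero (mem_of_closedBall_subset hε hsub) (add_smul_mem b hε hsub i)
    (add_smul_mem b hε hsub j) (sub_smul_mem b hε hsub j) (norm_sub_add_eq _ _)
    (norm_add_sub_eq_of_inner_eq_zero (norm_sub_add_eq _ _) ?_)
  rw [add_sub_sub_cancel, inner_add_right, real_inner_smul_left, real_inner_smul_right,
    inner_basis_of_ne b hij]
  simp

/-- Segments in the direction `b k` with the same perpendicular bisector have parallel images. -/
lemma exists_eq_smul_centralDiff (h : IsotonicPairOn B f g) (hε : 0 < ε)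
    (hsub : Metric.closedBall q (2 * ε) ⊆ B) {k : ι} {s : ℝ} {y y' : E} (hy : y ∈ B) (hy' : y' ∈ B)
    (hs : y - y' = s • b k) (he : ‖q - y‖ = ‖q - y'‖) :
    ∃ c : ℝ, g y - g y' = c • centralDiff g q (ε • b k) := by
  have : FiniteDimensional ℝ E := b.toBasis.finiteDimensional_of_finite
  have hq : q ∈ B := mem_of_closedBall_subset hε hsub
  refine exists_eq_smul_of_biorthogonal (u := fun i => f (q + ε • b i) - f q)
    (w := fun i => centralDiff g q (ε • b i)) (k := k)
    (Module.finrank_eq_card_basis b.toBasis).symm (h.inner_sub_centralDiff_ne_zero b hε hsub)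
    (fun i j hij => h.inner_sub_centralDiff_eq_zero b hε hsub hij) ?_
  intro i hik
  refine h.inner_eq_zero hq (add_smul_mem b hε hsub i) hy hy' he
    (norm_add_sub_eq_of_inner_eq_zero he ?_)
  rw [hs, real_inner_smul_left, real_inner_smul_right, inner_basis_of_ne b hik]
  simp

/-- Parallelograms inscribed in a sphere are rectangles. -/
lemma inner_eq_zero_of_inscribed {o a c d : E} (h1 : ‖o - (a + c)‖ = ‖o - a‖)
    (h2 : ‖o - (a + d)‖ = ‖o - a‖) (h3 : ‖o - (a + c + d)‖ = ‖o - a‖) : ⟪c, d⟫ = 0 := by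
  have e1 : ‖(o - a) - c‖ ^ 2 = ‖o - a‖ ^ 2 := by rw [← h1]; congr 2; abel
  have e2 : ‖(o - a) - d‖ ^ 2 = ‖o - a‖ ^ 2 := by rw [← h2]; congr 2; abel
  have e3 : ‖(o - a) - (c + d)‖ ^ 2 = ‖o - a‖ ^ 2 := by rw [← h3]; congr 2; abel
  rw [norm_sub_sq_real] at e1 e2 e3
  rw [inner_add_right, norm_add_sq_real] at e3
  linarith

/-- The images of orthogonal segments with a common midpoint are orthogonal. -/
lemma inner_centralDiff_eq_zero (h : IsotonicPairOn B f g) (hε : 0 < ε)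
    (hsub : Metric.closedBall q (2 * ε) ⊆ B) {i j : ι} (hij : i ≠ j) :
    ⟪centralDiff g q (ε • b i), centralDiff g q (ε • b j)⟫ = 0 := by
  have hq : q ∈ B := mem_of_closedBall_subset hε hsub
  set wi := centralDiff g q (ε • b i) with hwi
  set wj := centralDiff g q (ε • b j) with hwj
  have hni : ‖ε • b i‖ = ε := norm_smul_basis b hε i
  have hnj : ‖ε • b j‖ = ε := norm_smul_basis b hε j
  have hin : ⟪ε • b i, ε • b j⟫ = 0 := by
    rw [real_inner_smul_left, real_inner_smul_right, inner_basis_of_ne b hij]; simp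
  have hadd : ‖ε • b i + ε • b j‖ ≤ 2 * ε := (norm_add_le _ _).trans (by linarith)
  have hsubt : ‖ε • b i - ε • b j‖ ≤ 2 * ε := (norm_sub_le _ _).trans (by linarith)
  have hnorm : ‖ε • b i + ε • b j‖ = ‖ε • b i - ε • b j‖ := by
    rw [← sq_eq_sq₀ (norm_nonneg _) (norm_nonneg _), norm_add_sq_real, norm_sub_sq_real, hin]
    ring
  have key : ∀ v w : E, ‖v‖ = ‖w‖ → ‖q - (q + v)‖ = ‖q - (q + w)‖ := by
    intro v w hvw
    simpa using hvw
  -- the four vertices of a square centred at `q`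
  set a := ε • b i + ε • b j with ha
  set d := ε • b i - ε • b j with hd
  have m1 : q + a ∈ B := add_mem_of_norm_le hsub hadd
  have m2 : q + d ∈ B := add_mem_of_norm_le hsub hsubt
  have m3 : q + -d ∈ B := add_mem_of_norm_le hsub (by rwa [norm_neg])
  have m4 : q + -a ∈ B := add_mem_of_norm_le hsub (by rwa [norm_neg])
  have n12 := key a d hnorm
  have n34 := key (-d) (-a) (by rw [norm_neg, norm_neg, hnorm])
  have n13 := key a (-d) (by rw [norm_neg, hnorm])
  have n24 := key d (-a) (by rw [norm_neg, hnorm])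
  obtain ⟨α, hα⟩ := h.exists_eq_smul_centralDiff b hε hsub (k := j) (s := 2 * ε) m1 m2
    (by rw [ha, hd]; module) n12
  obtain ⟨β, hβ⟩ := h.exists_eq_smul_centralDiff b hε hsub (k := j) (s := 2 * ε) m3 m4
    (by rw [ha, hd]; module) n34
  obtain ⟨γ, hγ⟩ := h.exists_eq_smul_centralDiff b hε hsub (k := i) (s := 2 * ε) m1 m3
    (by rw [ha, hd]; module) n13
  obtain ⟨δ, hδ⟩ := h.exists_eq_smul_centralDiff b hε hsub (k := i) (s := 2 * ε) m2 m4
    (by rw [ha, hd]; module) n24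
  rw [← hwj] at hα hβ
  rw [← hwi] at hγ hδ
  set u := f (q + ε • b i) - f q with hu
  have hui : ⟪u, wi⟫ ≠ 0 := h.inner_sub_centralDiff_ne_zero b hε hsub i
  have huj : ⟪u, wj⟫ = 0 := h.inner_sub_centralDiff_eq_zero b hε hsub hij
  have hrel : (γ - δ) • wi = (α - β) • wj := by
    rw [sub_smul, sub_smul, ← hα, ← hβ, ← hγ, ← hδ]; abel
  have hγδ : γ = δ := by
    have h0 := congrArg (fun v => ⟪u, v⟫) hrel
    simp only [real_inner_smul_right, huj, mul_zero] at h0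
    exact sub_eq_zero.mp ((mul_eq_zero.mp h0).resolve_right hui)
  have hα0 : α ≠ 0 := by
    rintro rfl
    rw [zero_smul, sub_eq_zero] at hα
    have h0 := add_left_cancel (h.injOn m1 m2 hα)
    have h1 : ‖(2 : ℝ) • ε • b j‖ = 0 := by
      rw [norm_eq_zero, ← sub_eq_zero.mpr h0, ha, hd]; module
    rw [norm_smul, hnj] at h1
    norm_num at h1
    exact hε.ne' h1
  have hγ0 : γ ≠ 0 := by
    rintro rfl
    rw [zero_smul, sub_eq_zero] at hγ
    have h0 := add_left_cancel (h.injOn m1 m3 hγ)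
    have h1 : ‖(2 : ℝ) • ε • b i‖ = 0 := by
      rw [norm_eq_zero, ← sub_eq_zero.mpr h0, ha, hd]; module
    rw [norm_smul, hni] at h1
    norm_num at h1
    exact hε.ne' h1
  have e2 : g (q + a) + -(α • wj) = g (q + d) := by rw [← hα]; abel
  have e3 : g (q + a) + -(γ • wi) = g (q + -d) := by rw [← hγ]; abel
  have e4 : g (q + a) + -(γ • wi) + -(α • wj) = g (q + -a) := by
    rw [hγδ, ← hα, ← hδ]; abel
  have horth : ⟪-(γ • wi), -(α • wj)⟫ = 0 := by
    refine inner_eq_zero_of_inscribed (o := f q) (a := g (q + a)) ?_ ?_ ?_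
    · rw [e3]; exact (h.norm_eq hq m1 m3 n13).symm
    · rw [e2]; exact (h.norm_eq hq m1 m2 n12).symm
    · rw [e4]; exact ((h.norm_eq hq m1 m3 n13).trans (h.norm_eq hq m3 m4 n34)).symm
  rw [inner_neg_neg, real_inner_smul_left, real_inner_smul_right] at horth
  exact (mul_eq_zero.mp ((mul_eq_zero.mp horth).resolve_left hγ0)).resolve_left hα0

/-- All segments of `B` in the direction `b k` have images parallel to a fixed vector. -/
lemma exists_eq_smul_centralDiff_center {z : E} {r : ℝ} (h : IsotonicPairOn (Metric.ball z r) f g)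
    (hε : 0 < ε) (hsub : Metric.closedBall z (2 * ε) ⊆ Metric.ball z r) {k : ι} {s : ℝ} {y y' : E}
    (hy : y ∈ Metric.ball z r) (hy' : y' ∈ Metric.ball z r) (hs : y - y' = s • b k) :
    ∃ c : ℝ, g y - g y' = c • centralDiff g z (ε • b k) := by
  have : FiniteDimensional ℝ E := b.toBasis.finiteDimensional_of_finite
  set m : E := midpoint ℝ y y' with hm
  have hmB : m ∈ Metric.ball z r := (convex_ball z r).midpoint_mem hy hy'
  have hbk : ⟪b k, b k⟫ = 1 := by rw [real_inner_self_eq_norm_sq, b.norm_eq_one, one_pow]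
  set q : E := z + ⟪b k, m - z⟫ • b k with hq
  have hqB : q ∈ Metric.ball z r := by
    rw [Metric.mem_ball, dist_eq_norm] at hmB ⊢
    rw [hq, add_sub_cancel_left, norm_smul, b.norm_eq_one, mul_one]
    calc ‖⟪b k, m - z⟫‖ ≤ ‖b k‖ * ‖m - z‖ := norm_inner_le_norm _ _
      _ < r := by rw [b.norm_eq_one, one_mul]; exact hmB
  obtain ⟨η, hη, hηB⟩ : ∃ η > 0, Metric.closedBall q (2 * η) ⊆ Metric.ball z r := by
    obtain ⟨η, hη, hηB⟩ := Metric.nhds_basis_closedBall.mem_iff.mp (Metric.isOpen_ball.mem_nhds hqB)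
    exact ⟨η / 2, half_pos hη, by rwa [mul_div_cancel₀ _ two_ne_zero]⟩
  have hqm : ⟪q - m, b k⟫ = 0 := by
    rw [show q - m = ⟪b k, m - z⟫ • b k - (m - z) by rw [hq]; abel, inner_sub_left,
      real_inner_smul_left, hbk, real_inner_comm]
    ring
  have hqy : ‖q - y‖ = ‖q - y'‖ := by
    have hmy : ‖m - y‖ = ‖m - y'‖ := by
      rw [← dist_eq_norm, ← dist_eq_norm, hm, dist_midpoint_left, dist_midpoint_right]
    have := norm_add_sub_eq_of_inner_eq_zero (v := q - m) hmy
      (by rw [hs, real_inner_smul_right, hqm, mul_zero])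
    rwa [add_sub_cancel] at this
  obtain ⟨c, hc⟩ := h.exists_eq_smul_centralDiff b hη hηB hy hy' hs hqy
  obtain ⟨c', hc'⟩ : ∃ c' : ℝ, centralDiff g q (η • b k) = c' • centralDiff g z (ε • b k) := by
    refine exists_eq_smul_of_biorthogonal (u := fun i => centralDiff g z (ε • b i))
      (w := fun i => centralDiff g z (ε • b i)) (k := k)
      (Module.finrank_eq_card_basis b.toBasis).symm ?_ ?_ ?_
    · exact fun i => inner_self_ne_zero.mpr (h.centralDiff_ne_zero b hε hsub i)
    · exact fun i j hij => h.inner_centralDiff_eq_zero b hε hsub hij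
    · intro i hik
      have hzq : ‖z - (q + η • b i)‖ = ‖z - (q - η • b i)‖ := by
        have := norm_add_sub_eq_of_inner_eq_zero (v := z - q) (norm_sub_add_eq q (η • b i)) (by
          rw [hq, sub_add_cancel_left, add_sub_sub_cancel, inner_add_right, inner_neg_left,
            real_inner_smul_left, real_inner_smul_right, inner_basis_of_ne b hik.symm]
          simp)
        rwa [add_sub_cancel] at this
      obtain ⟨a, ha⟩ := h.exists_eq_smul_centralDiff b hε hsub (k := i) (s := 2 * η)
        (add_smul_mem b hη hηB i) (sub_smul_mem b hη hηB i) (by module) hzq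
      change centralDiff g q (η • b i) = _ at ha
      have horth := h.inner_centralDiff_eq_zero b hη hηB hik
      rw [ha, real_inner_smul_left] at horth
      refine (mul_eq_zero.mp horth).resolve_left ?_
      rintro rfl
      exact h.centralDiff_ne_zero b hη hηB i (by rw [ha, zero_smul])
  exact ⟨c * c', by rw [hc, hc', smul_smul]⟩

/-- `g` maps parallel segments of the ball to parallel segments. -/
lemma exists_sub_eq_smul_sub [FiniteDimensional ℝ E] {z : E} {r : ℝ}
    (h : IsotonicPairOn (Metric.ball z r) f g) {y₁ y₂ y₃ y₄ : E}
    (h₁ : y₁ ∈ Metric.ball z r) (h₂ : y₂ ∈ Metric.ball z r) (h₃ : y₃ ∈ Metric.ball z r)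
    (h₄ : y₄ ∈ Metric.ball z r) (hne : y₃ ≠ y₄) {c : ℝ} (hc : y₂ - y₁ = c • (y₄ - y₃)) :
    ∃ c' : ℝ, g y₂ - g y₁ = c' • (g y₄ - g y₃) := by
  have hr : 0 < r := Metric.pos_of_mem_ball h₁
  have hnorm : ‖y₄ - y₃‖ ≠ 0 := norm_ne_zero_iff.mpr (sub_ne_zero.mpr hne.symm)
  have hpos : 0 < Module.finrank ℝ E :=
    Module.finrank_pos_iff_exists_ne_zero.mpr ⟨_, norm_ne_zero_iff.mp hnorm⟩
  let k : Fin (Module.finrank ℝ E) := ⟨0, hpos⟩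
  obtain ⟨b, hb⟩ : ∃ b : OrthonormalBasis (Fin (Module.finrank ℝ E)) ℝ E,
      ∀ i ∈ ({k} : Set (Fin (Module.finrank ℝ E))), b i = ‖y₄ - y₃‖⁻¹ • (y₄ - y₃) := by
    refine Orthonormal.exists_orthonormalBasis_extension_of_card_eq (by simp)
      (v := fun _ => ‖y₄ - y₃‖⁻¹ • (y₄ - y₃)) ⟨fun i => ?_, fun i j hij => ?_⟩
    · simp [norm_smul, hnorm]
    · exact absurd (Subsingleton.elim i j) hij
  have hdir : y₄ - y₃ = ‖y₄ - y₃‖ • b k := by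
    rw [hb k rfl, smul_smul, mul_inv_cancel₀ hnorm, one_smul]
  have hsub : Metric.closedBall z (2 * (r / 4)) ⊆ Metric.ball z r :=
    Metric.closedBall_subset_ball (by linarith)
  obtain ⟨a, ha⟩ := h.exists_eq_smul_centralDiff_center b (by linarith) hsub h₄ h₃ hdir
  obtain ⟨a', ha'⟩ := h.exists_eq_smul_centralDiff_center b (s := c * ‖y₄ - y₃‖) (k := k)
    (by linarith) hsub h₂ h₁ (by rw [hc, mul_smul, ← hdir])
  have ha0 : a ≠ 0 := by
    rintro rfl
    rw [zero_smul, sub_eq_zero] at ha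
    exact hne (h.injOn h₃ h₄ ha.symm)
  exact ⟨a' / a, by rw [ha, ha', smul_smul, div_mul_cancel₀ _ ha0]⟩

end IsotonicPairOn

end UnfoldingPair


/-- **Lemma: `g` maps lines into lines and preserves
parallelism.** Let `p ≥ 1`, let `B ⊆ ℝ^p` be a non-empty open ball, and let
`(f, g)` be an isotonic unfolding pair on `(B, B)`. Then (i) `g` maps collinear
triples of `B` to collinear triples, and (ii) `g` preserves parallelism of
segments. -/
theorem internal_unfolding_lines
    (p : ℕ) (hp : 1 ≤ p) (B : Set (EuclideanSpace ℝ (Fin p)))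
    (hB : ∃ (z : EuclideanSpace ℝ (Fin p)) (r : ℝ), 0 < r ∧ B = Metric.ball z r)
    (f g : EuclideanSpace ℝ (Fin p) → EuclideanSpace ℝ (Fin p))
    (hf_inj : Set.InjOn f B) (hg_inj : Set.InjOn g B)
    (hpair : ∀ x ∈ B, ∀ y ∈ B, ∀ y' ∈ B,
      (‖x - y‖ < ‖x - y'‖ ↔ ‖f x - g y‖ < ‖f x - g y'‖)) :
    (∀ y₁ ∈ B, ∀ y₂ ∈ B, ∀ y₃ ∈ B,
      Collinear ℝ ({y₁, y₂, y₃} : Set (EuclideanSpace ℝ (Fin p))) →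
      Collinear ℝ ({g y₁, g y₂, g y₃} : Set (EuclideanSpace ℝ (Fin p)))) ∧
    (∀ y₁ ∈ B, ∀ y₂ ∈ B, ∀ y₃ ∈ B, ∀ y₄ ∈ B,
      y₁ ≠ y₂ → y₃ ≠ y₄ → (∃ c : ℝ, y₂ - y₁ = c • (y₄ - y₃)) →
      ∃ c' : ℝ, g y₂ - g y₁ = c' • (g y₄ - g y₃)) := by
  obtain ⟨z, r, -, rfl⟩ := hB
  have h : IsotonicPairOn (Metric.ball z r) f g := ⟨hg_inj, hpair⟩
  refine ⟨fun y₁ h₁ y₂ h₂ y₃ h₃ hcol => ?_, fun y₁ h₁ y₂ h₂ y₃ h₃ y₄ h₄ _ hne ⟨c, hc⟩ =>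
    h.exists_sub_eq_smul_sub h₁ h₂ h₃ h₄ hne hc⟩
  by_cases h12 : y₁ = y₂
  · subst h12
    simpa using collinear_pair ℝ (g y₁) (g y₃)
  obtain ⟨c, hc⟩ : ∃ c : ℝ, y₃ - y₁ = c • (y₂ - y₁) := by
    obtain ⟨v, hv⟩ := (collinear_iff_of_mem (p₀ := y₁) (by simp)).mp hcol
    obtain ⟨s, hs⟩ := hv y₂ (by simp)
    obtain ⟨t, ht⟩ := hv y₃ (by simp)
    rw [vadd_eq_add] at hs ht
    have hs0 : s ≠ 0 := by
      rintro rfl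
      exact h12 (by rw [hs, zero_smul, zero_add])
    exact ⟨t / s, by
      rw [hs, ht, add_sub_cancel_right, add_sub_cancel_right, smul_smul, div_mul_cancel₀ _ hs0]⟩
  obtain ⟨c', hc'⟩ := h.exists_sub_eq_smul_sub h₁ h₃ h₁ h₂ h12 hc
  rw [collinear_iff_of_mem (p₀ := g y₁) (by simp)]
  refine ⟨g y₂ - g y₁, ?_⟩
  simp only [Set.mem_insert_iff, Set.mem_singleton_iff, vadd_eq_add]
  rintro x (rfl | rfl | rfl)
  · exact ⟨0, by simp⟩
  · exact ⟨1, by simp⟩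
  · exact ⟨c', by rw [← hc', sub_add_cancel]⟩
end

section
/- Let p ≥ 1, let B ⊆ ℝ^p be a non-empty open ball with 0 ∈ B, and let f : B → ℝ^p and g : B → ℝ^p form an isotonic unfolding pair on (B, B) with g(0) = 0. Then for all y₀, y₁ ∈ B such that y₀ and y₁ are linearly independent and y₀ + y₁ ∈ B, one has g(y₀ + y₁) = g(y₀) + g(y₁). -/
open Module
open scoped RealInnerProductSpace

section IsotonicPairs

variable {E : Type*} [NormedAddCommGroup E]

/-- The isotonicity condition of an unfolding pair on `(B, B)`. -/
def IsIsotonicPair (B : Set E) (f g : E → E) : Prop :=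
  ∀ x ∈ B, ∀ y ∈ B, ∀ y' ∈ B, (‖x - y‖ < ‖x - y'‖ ↔ ‖f x - g y‖ < ‖f x - g y'‖)

namespace IsIsotonicPair

variable {B : Set E} {f g : E → E}

lemma norm_sub_eq_iff (h : IsIsotonicPair B f g) {x y y' : E} (hx : x ∈ B) (hy : y ∈ B)
    (hy' : y' ∈ B) : ‖x - y‖ = ‖x - y'‖ ↔ ‖f x - g y‖ = ‖f x - g y'‖ := by
  have h₁ := h x hx y hy y' hy'
  have h₂ := h x hx y' hy' y hy
  rw [le_antisymm_iff, le_antisymm_iff, ← not_lt, ← not_lt, ← not_lt, ← not_lt, h₁, h₂]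

lemma apply_ne (h : IsIsotonicPair B f g) {y y' : E} (hy : y ∈ B) (hy' : y' ∈ B)
    (hne : y ≠ y') : g y ≠ g y' := fun hg => by
  have := (h.norm_sub_eq_iff hy hy hy').2 (by rw [hg])
  rw [sub_self, norm_zero, eq_comm, norm_eq_zero, sub_eq_zero] at this
  exact hne this

end IsIsotonicPair

variable [InnerProductSpace ℝ E]

lemma norm_sub_lt_norm_sub_iff_inner (z y y' : E) :
    ‖z - y‖ < ‖z - y'‖ ↔ 2 * ⟪y' - y, z⟫ < ‖y'‖ ^ 2 - ‖y‖ ^ 2 := by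
  rw [← pow_lt_pow_iff_left₀ (norm_nonneg _) (norm_nonneg _) two_ne_zero, norm_sub_sq_real,
    norm_sub_sq_real, inner_sub_left, real_inner_comm y, real_inner_comm y']
  constructor <;> intro h <;> linarith

lemma norm_sub_eq_norm_sub_iff_inner (z y y' : E) :
    ‖z - y‖ = ‖z - y'‖ ↔ 2 * ⟪y' - y, z⟫ = ‖y'‖ ^ 2 - ‖y‖ ^ 2 := by
  rw [← pow_left_inj₀ (norm_nonneg _) (norm_nonneg _) two_ne_zero, norm_sub_sq_real,
    norm_sub_sq_real, inner_sub_left, real_inner_comm y, real_inner_comm y']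
  constructor <;> intro h <;> linarith

lemma convex_setOf_norm_sub_lt (y y' : E) : Convex ℝ {z : E | ‖z - y‖ < ‖z - y'‖} := by
  have h : {z : E | ‖z - y‖ < ‖z - y'‖} =
      {z : E | innerSL ℝ (y' - y) z < (‖y'‖ ^ 2 - ‖y‖ ^ 2) / 2} := by
    ext z
    simp only [Set.mem_ofPred_eq, norm_sub_lt_norm_sub_iff_inner, innerSL_apply_apply]
    constructor <;> intro h <;> linarith
  rw [h]
  exact convex_halfSpace_lt (innerSL ℝ (y' - y)).isLinear _

lemma exists_orthogonal_norm_eq [FiniteDimensional ℝ E] (hdim : 2 ≤ finrank ℝ E) {v : E}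
    (hv : v ≠ 0) : ∃ w : E, w ≠ 0 ∧ ⟪v, w⟫ = 0 ∧ ‖w‖ = ‖v‖ := by
  have hadd := Submodule.finrank_add_finrank_orthogonal (Submodule.span ℝ {v})
  rw [finrank_span_singleton hv] at hadd
  have hne : (Submodule.span ℝ {v})ᗮ ≠ ⊥ := fun hbot => by
    rw [hbot, finrank_bot] at hadd
    omega
  obtain ⟨w, hw, hw0⟩ := Submodule.exists_mem_ne_zero_of_ne_bot hne
  rw [Submodule.mem_orthogonal_singleton_iff_inner_right] at hw
  have hwn := norm_ne_zero_iff.2 hw0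
  have hvn := norm_ne_zero_iff.2 hv
  refine ⟨(‖v‖ / ‖w‖) • w, smul_ne_zero (div_ne_zero hvn hwn) hw0, ?_, ?_⟩
  · rw [inner_smul_right, hw, mul_zero]
  · rw [norm_smul, Real.norm_of_nonneg (by positivity), div_mul_cancel₀ _ hwn]

/-- Finite subsets of an open convex set with disjoint convex hulls are separated by the
perpendicular bisector of two points of that set. -/
lemma exists_bisector_separating [CompleteSpace E] {B S T : Set E} (hBo : IsOpen B)
    (hBc : Convex ℝ B) (hS : S.Finite) (hT : T.Finite) (hSB : S ⊆ B) (hTB : T ⊆ B)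
    (hSne : S.Nonempty) (hTne : T.Nonempty)
    (hd : Disjoint (convexHull ℝ S) (convexHull ℝ T)) :
    ∃ y ∈ B, ∃ y' ∈ B, (∀ x ∈ S, ‖x - y‖ < ‖x - y'‖) ∧ ∀ x ∈ T, ‖x - y'‖ < ‖x - y‖ := by
  obtain ⟨ℓ, u, v, hSu, huv, hTv⟩ := geometric_hahn_banach_compact_closed
    (convex_convexHull ℝ S) (hS.isCompact_convexHull ℝ) (convex_convexHull ℝ T)
    (hT.isClosed_convexHull ℝ) hd
  replace hSu : ∀ x ∈ S, ℓ x < u := fun x hx => hSu x (subset_convexHull ℝ S hx)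
  replace hTv : ∀ x ∈ T, u < ℓ x := fun x hx => huv.trans (hTv x (subset_convexHull ℝ T hx))
  obtain ⟨a, ha⟩ := hSne
  obtain ⟨b, hb⟩ := hTne
  obtain ⟨m, hm, hmu⟩ : ∃ m ∈ B, ℓ m = u :=
    hBc.isPreconnected.intermediate_value (hSB ha) (hTB hb) ℓ.continuous.continuousOn
      ⟨(hSu a ha).le, (hTv b hb).le⟩
  set n := (InnerProductSpace.toDual ℝ E).symm ℓ with hn
  have hℓ : ∀ x, ⟪n, x⟫ = ℓ x := fun x => by simp [hn]
  obtain ⟨ε, hε, hball⟩ := Metric.isOpen_iff.1 hBo m hm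
  obtain ⟨s, hs, hsn⟩ : ∃ s : ℝ, 0 < s ∧ ‖s • n‖ < ε := by
    refine ⟨ε / (‖n‖ + 1), by positivity, ?_⟩
    rw [norm_smul, Real.norm_of_nonneg (by positivity), div_mul_eq_mul_div,
      div_lt_iff₀ (by positivity)]
    nlinarith
  have key : ‖m + s • n‖ ^ 2 - ‖m - s • n‖ ^ 2 = 4 * s * u := by
    rw [norm_add_sq_real, norm_sub_sq_real, inner_smul_right, real_inner_comm, hℓ, hmu]
    ring
  have hi : ∀ x, ⟪(m + s • n) - (m - s • n), x⟫ = 2 * s * ℓ x := fun x => by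
    rw [show (m + s • n) - (m - s • n) = (2 * s) • n by module, inner_smul_left, hℓ]
    simp
  have hi' : ∀ x, ⟪(m - s • n) - (m + s • n), x⟫ = -(2 * s * ℓ x) := fun x => by
    rw [← hi, ← inner_neg_left, neg_sub]
  refine ⟨m - s • n, hball (by simpa [sub_eq_add_neg] using hsn), m + s • n,
    hball (by simpa using hsn), fun x hx => ?_, fun x hx => ?_⟩
  · rw [norm_sub_lt_norm_sub_iff_inner, key, hi]
    nlinarith [hSu x hx]
  · rw [norm_sub_lt_norm_sub_iff_inner, hi', ← neg_sub, key]
    nlinarith [hTv x hx]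

namespace IsIsotonicPair

variable {B : Set E} {f g : E → E}

lemma affineIndependent_comp [CompleteSpace E] (h : IsIsotonicPair B f g) (hBo : IsOpen B)
    (hBc : Convex ℝ B) {ι : Type*} [Finite ι] {x : ι → E} (hxB : ∀ i, x i ∈ B)
    (hx : AffineIndependent ℝ x) : AffineIndependent ℝ (f ∘ x) := by
  by_contra hfx
  obtain ⟨I, w, hwI, hwJ⟩ := Convex.radon_partition hfx
  have hne : ∀ K : Set ι, w ∈ convexHull ℝ ((f ∘ x) '' K) → (x '' K).Nonempty := fun K hK =>
    (Set.image_nonempty.1 (convexHull_nonempty_iff.1 ⟨w, hK⟩)).image x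
  have hd : Disjoint (convexHull ℝ (x '' I)) (convexHull ℝ (x '' Iᶜ)) := by
    classical
    have := Fintype.ofFinite ι
    have hr : AffineIndependent ℝ
        (fun z : ((Finset.univ.image x : Finset E) : Set E) => (z : E)) := by
      rw [Finset.coe_image, Finset.coe_univ, Set.image_univ]
      exact hx.range
    have := AffineIndependent.convexHull_inter (R := ℝ) (s := Finset.univ.image x)
      (t₁ := I.toFinset.image x) (t₂ := Iᶜ.toFinset.image x)
      hr
      (Finset.image_subset_image (Finset.subset_univ _))
      (Finset.image_subset_image (Finset.subset_univ _))
    rw [Set.disjoint_iff_inter_eq_empty]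
    simpa [← Set.image_inter hx.injective] using this.symm
  obtain ⟨y, hy, y', hy', hI, hJ⟩ := exists_bisector_separating hBo hBc (I.toFinite.image x)
    (Iᶜ.toFinite.image x) (by grind) (by grind) (hne I hwI) (hne Iᶜ hwJ) hd
  have h₁ : w ∈ {z : E | ‖z - g y‖ < ‖z - g y'‖} := by
    refine convexHull_min ?_ (convex_setOf_norm_sub_lt _ _) hwI
    rintro _ ⟨i, hi, rfl⟩
    exact (h _ (hxB i) y hy y' hy').1 (hI _ ⟨i, hi, rfl⟩)
  have h₂ : w ∈ {z : E | ‖z - g y'‖ < ‖z - g y‖} := by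
    refine convexHull_min ?_ (convex_setOf_norm_sub_lt _ _) hwJ
    rintro _ ⟨i, hi, rfl⟩
    exact (h _ (hxB i) y' hy' y hy).1 (hJ _ ⟨i, hi, rfl⟩)
  rw [Set.mem_ofPred_eq] at h₁ h₂
  exact lt_asymm h₁ h₂

lemma finrank_vectorSpan_le [FiniteDimensional ℝ E] (h : IsIsotonicPair B f g) (hBo : IsOpen B)
    (hBc : Convex ℝ B) {S : Set E} (hS : S ⊆ B) :
    finrank ℝ (vectorSpan ℝ S) ≤ finrank ℝ (vectorSpan ℝ (f '' S)) := by
  obtain ⟨t, htS, hspan, hind⟩ := exists_affineIndependent ℝ E S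
  have := finite_of_fin_dim_affineIndependent ℝ hind
  have := Fintype.ofFinite t
  rw [← direction_affineSpan, ← hspan, direction_affineSpan]
  have himg := h.affineIndependent_comp hBo hBc (fun i : t => hS (htS i.2)) hind
  have h₁ := himg.card_le_finrank_succ
  rcases isEmpty_or_nonempty t with ht | ht
  · rw [Set.isEmpty_coe_sort.1 ht, vectorSpan_empty, finrank_bot]
    exact Nat.zero_le _
  have h₂ : finrank ℝ (vectorSpan ℝ t) + 1 ≤ Fintype.card t := by
    have := finrank_vectorSpan_range_add_one_le ℝ (Subtype.val : t → E)
    rw [Subtype.range_coe] at this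
    exact this
  have h₃ : vectorSpan ℝ (Set.range (f ∘ ((↑) : t → E))) ≤ vectorSpan ℝ (f '' S) :=
    vectorSpan_mono ℝ (by rintro _ ⟨i, rfl⟩; exact ⟨i, htS i.2, rfl⟩)
  have h₄ := Submodule.finrank_mono h₃
  omega

/-- `g` maps opposite sides of a rectangle to parallel segments. -/
lemma exists_eq_smul [FiniteDimensional ℝ E] (h : IsIsotonicPair B f g) (hBo : IsOpen B)
    (hBc : Convex ℝ B) {q a b : E} (ha : a ≠ 0) (hab : ⟪a, b⟫ = 0) (hq : q ∈ B)
    (hqa : q + a ∈ B) (hqb : q + b ∈ B) (hqab : q + a + b ∈ B) :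
    ∃ r : ℝ, g (q + a + b) - g (q + b) = r • (g (q + a) - g q) := by
  set u := g (q + a) - g q
  set u' := g (q + a + b) - g (q + b)
  have hu0 : u ≠ 0 := sub_ne_zero.2 (h.apply_ne hqa hq (by simpa using ha))
  by_contra! hno
  have hli : LinearIndependent ℝ ![u, u'] :=
    (LinearIndependent.pair_iff' hu0).2 fun r hr => hno r hr.symm
  set S : Set E := {x | x ∈ B ∧ ‖x - q‖ = ‖x - (q + a)‖}
  have hmid : q + (1 / 2 : ℝ) • a ∈ B := by
    convert hBc hq hqa (a := 1 / 2) (b := 1 / 2) (by norm_num) (by norm_num) (by norm_num) using 1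
    module
  have hbis : ∀ w, ⟪a, w⟫ = 0 → ∀ p' ∈ ({q, q + b} : Set E),
      ‖q + (1 / 2 : ℝ) • a + w - p'‖ = ‖q + (1 / 2 : ℝ) • a + w - (p' + a)‖ := by
    intro w hw p' hp'
    rw [norm_sub_eq_norm_sub_iff_inner, norm_add_sq_real, add_sub_cancel_left, inner_add_right,
      inner_add_right, hw, inner_smul_right, real_inner_self_eq_norm_sq]
    rcases hp' with rfl | rfl
    · rw [real_inner_comm]; ring
    · rw [inner_add_left]; linarith [real_inner_comm a q, real_inner_comm a b]
  have hS' : ∀ x ∈ S, ‖x - (q + b)‖ = ‖x - (q + a + b)‖ := by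
    rintro x ⟨-, hx⟩
    have hw : ⟪a, x - (q + (1 / 2 : ℝ) • a)⟫ = 0 := by
      rw [norm_sub_eq_norm_sub_iff_inner, norm_add_sq_real, add_sub_cancel_left,
        real_inner_comm] at hx
      rw [inner_sub_right, inner_add_right, inner_smul_right, real_inner_self_eq_norm_sq,
        real_inner_comm]
      linarith [real_inner_comm a q, real_inner_comm a x]
    have := hbis _ hw (q + b) (by simp)
    rwa [add_sub_cancel, add_right_comm] at this
  have hle : (Submodule.span ℝ {a})ᗮ ≤ vectorSpan ℝ S := by
    intro w hw
    rw [Submodule.mem_orthogonal_singleton_iff_inner_right] at hw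
    obtain ⟨ε, hε, hball⟩ := Metric.isOpen_iff.1 hBo _ hmid
    obtain ⟨s, hs, hsw⟩ : ∃ s : ℝ, 0 < s ∧ ‖s • w‖ < ε := by
      refine ⟨ε / (‖w‖ + 1), by positivity, ?_⟩
      rw [norm_smul, Real.norm_of_nonneg (by positivity), div_mul_eq_mul_div,
        div_lt_iff₀ (by positivity)]
      nlinarith
    have h₁ : q + (1 / 2 : ℝ) • a + s • w ∈ S :=
      ⟨hball (by simpa using hsw), hbis _ (by rw [inner_smul_right, hw, mul_zero]) q (by simp)⟩
    have h₂ : q + (1 / 2 : ℝ) • a ∈ S :=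
      ⟨hmid, by simpa using hbis 0 (by simp) q (by simp)⟩
    have h₃ := vsub_mem_vectorSpan ℝ h₁ h₂
    rw [vsub_eq_sub, add_sub_cancel_left] at h₃
    simpa [smul_smul, hs.ne'] using (vectorSpan ℝ S).smul_mem s⁻¹ h₃
  have hle' : vectorSpan ℝ (f '' S) ≤ (Submodule.span ℝ (Set.range ![u, u']))ᗮ := by
    rw [vectorSpan, Submodule.span_le]
    rintro _ ⟨_, ⟨x, hx, rfl⟩, _, ⟨x', hx', rfl⟩, rfl⟩
    have h₁ : ∀ z ∈ S, 2 * ⟪u, f z⟫ = ‖g (q + a)‖ ^ 2 - ‖g q‖ ^ 2 := fun z hz =>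
      (norm_sub_eq_norm_sub_iff_inner _ _ _).1 ((h.norm_sub_eq_iff hz.1 hq hqa).1 hz.2)
    have h₂ : ∀ z ∈ S, 2 * ⟪u', f z⟫ = ‖g (q + a + b)‖ ^ 2 - ‖g (q + b)‖ ^ 2 := fun z hz =>
      (norm_sub_eq_norm_sub_iff_inner _ _ _).1 ((h.norm_sub_eq_iff hz.1 hqb hqab).1 (hS' z hz))
    rw [SetLike.mem_coe, Submodule.mem_orthogonal]
    intro y hy
    induction hy using Submodule.span_induction with
    | mem y hy =>
      simp only [Matrix.range_cons, Matrix.range_empty, Set.union_empty, Set.singleton_union,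
        Set.mem_insert_iff, Set.mem_singleton_iff] at hy
      simp only [vsub_eq_sub, inner_sub_right]
      rcases hy with rfl | rfl
      · linarith [h₁ x hx, h₁ x' hx']
      · linarith [h₂ x hx, h₂ x' hx']
    | zero => simp
    | add y z _ _ hy hz => rw [inner_add_left, hy, hz, add_zero]
    | smul r y _ hy => rw [inner_smul_left, hy, mul_zero]
  have h₁ := Submodule.finrank_add_finrank_orthogonal (Submodule.span ℝ {a})
  have h₂ := Submodule.finrank_add_finrank_orthogonal (Submodule.span ℝ (Set.range ![u, u']))
  rw [finrank_span_singleton ha] at h₁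
  rw [finrank_span_eq_card hli, Fintype.card_fin] at h₂
  have h₃ := Submodule.finrank_mono hle
  have h₄ := Submodule.finrank_mono hle'
  have h₅ := h.finrank_vectorSpan_le hBo hBc (S := S) fun x hx => hx.1
  omega

/-- `g` maps rectangles to parallelograms. -/
lemma apply_rectangle [FiniteDimensional ℝ E] (h : IsIsotonicPair B f g) (hBo : IsOpen B)
    (hBc : Convex ℝ B) {q a b : E} (ha : a ≠ 0) (hb : b ≠ 0) (hab : ⟪a, b⟫ = 0) (hq : q ∈ B)
    (hqa : q + a ∈ B) (hqb : q + b ∈ B) (hqab : q + a + b ∈ B) :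
    g q + g (q + a + b) = g (q + a) + g (q + b) := by
  obtain ⟨r, hr⟩ := h.exists_eq_smul hBo hBc ha hab hq hqa hqb hqab
  obtain ⟨s, hs⟩ := h.exists_eq_smul hBo hBc hb (by rwa [real_inner_comm]) hq hqb hqa
    (by rwa [add_right_comm])
  rw [add_right_comm] at hs
  have hrel : (1 - r) • (g (q + a) - g q) = (1 - s) • (g (q + b) - g q) := by
    rw [sub_smul, sub_smul, ← hr, ← hs]
    module
  rcases eq_or_ne r 1 with rfl | hr1
  · rw [one_smul, sub_eq_sub_iff_add_eq_add] at hr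
    rw [add_comm, hr]
  exfalso
  have hmid : q + (1 / 2 : ℝ) • a ∈ B := by
    convert hBc hq hqa (a := 1 / 2) (b := 1 / 2) (by norm_num) (by norm_num) (by norm_num) using 1
    module
  have hcen : q + (1 / 2 : ℝ) • a + (1 / 2 : ℝ) • b ∈ B := by
    convert hBc hq hqab (a := 1 / 2) (b := 1 / 2) (by norm_num) (by norm_num) (by norm_num) using 1
    module
  have hba : ⟪b, a⟫ = 0 := by rwa [real_inner_comm]
  have hs1 : 1 - s ≠ 0 := by
    intro hs0
    rw [hs0, zero_smul, smul_eq_zero] at hrel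
    rcases hrel with h' | h'
    · exact hr1 (sub_eq_zero.1 h').symm
    · exact h.apply_ne hqa hq (by simpa using ha) (sub_eq_zero.1 h')
  have e₁ : ∀ t : ℝ,
      ‖q + (1 / 2 : ℝ) • a + t • b - q‖ = ‖q + (1 / 2 : ℝ) • a + t • b - (q + a)‖ := by
    intro t
    rw [norm_sub_eq_norm_sub_iff_inner, norm_add_sq_real, add_sub_cancel_left]
    simp only [inner_add_right, inner_smul_right, hab, real_inner_self_eq_norm_sq]
    rw [real_inner_comm]
    ring
  have e₂ : ‖q + (1 / 2 : ℝ) • a + (1 / 2 : ℝ) • b - q‖ =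
      ‖q + (1 / 2 : ℝ) • a + (1 / 2 : ℝ) • b - (q + b)‖ := by
    rw [norm_sub_eq_norm_sub_iff_inner, norm_add_sq_real, add_sub_cancel_left]
    simp only [inner_add_right, inner_smul_right, hba, real_inner_self_eq_norm_sq]
    rw [real_inner_comm]
    ring
  have e₃ : ¬ ‖q + (1 / 2 : ℝ) • a - q‖ = ‖q + (1 / 2 : ℝ) • a - (q + b)‖ := by
    rw [norm_sub_eq_norm_sub_iff_inner, norm_add_sq_real, add_sub_cancel_left]
    simp only [inner_add_right, inner_smul_right, hba]
    rw [real_inner_comm]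
    have : 0 < ‖b‖ ^ 2 := by positivity
    intro h'
    linarith
  apply e₃
  have e₀ := e₁ 0
  rw [zero_smul, add_zero, h.norm_sub_eq_iff hmid hq hqa, norm_sub_eq_norm_sub_iff_inner] at e₀
  have e₁' := e₁ (1 / 2)
  rw [h.norm_sub_eq_iff hcen hq hqa, norm_sub_eq_norm_sub_iff_inner] at e₁'
  rw [h.norm_sub_eq_iff hcen hq hqb, norm_sub_eq_norm_sub_iff_inner] at e₂
  rw [h.norm_sub_eq_iff hmid hq hqb, norm_sub_eq_norm_sub_iff_inner, ← e₂]
  have k₁ := congrArg (fun z => ⟪z, f (q + (1 / 2 : ℝ) • a)⟫) hrel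
  have k₂ := congrArg (fun z => ⟪z, f (q + (1 / 2 : ℝ) • a + (1 / 2 : ℝ) • b)⟫) hrel
  simp only [inner_smul_left, conj_trivial] at k₁ k₂
  congr 1
  apply mul_left_cancel₀ hs1
  rw [← k₁, ← k₂]
  congr 1
  linarith

/-- `g` maps rectangles to rectangles. -/
lemma inner_apply_rectangle [FiniteDimensional ℝ E] (h : IsIsotonicPair B f g) (hBo : IsOpen B)
    (hBc : Convex ℝ B) {q a b : E} (ha : a ≠ 0) (hb : b ≠ 0) (hab : ⟪a, b⟫ = 0) (hq : q ∈ B)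
    (hqa : q + a ∈ B) (hqb : q + b ∈ B) (hqab : q + a + b ∈ B) :
    ⟪g (q + a) - g q, g (q + b) - g q⟫ = 0 := by
  have hpar := h.apply_rectangle hBo hBc ha hb hab hq hqa hqb hqab
  set c := q + (1 / 2 : ℝ) • (a + b) with hc
  have hcB : c ∈ B := by
    convert hBc hq hqab (a := 1 / 2) (b := 1 / 2) (by norm_num) (by norm_num) (by norm_num) using 1
    module
  have hnorm : ‖a + b‖ = ‖a - b‖ := by
    rw [← pow_left_inj₀ (norm_nonneg _) (norm_nonneg _) two_ne_zero, norm_add_sq_real,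
      norm_sub_sq_real, hab]
    ring
  have n₀ : ‖c - q‖ = ‖(1 / 2 : ℝ) • (a + b)‖ := by rw [hc, add_sub_cancel_left]
  have n₁ : ‖c - (q + a)‖ = ‖(1 / 2 : ℝ) • (a - b)‖ := by
    rw [← norm_neg, hc]; congr 1; module
  have n₂ : ‖c - (q + b)‖ = ‖(1 / 2 : ℝ) • (a - b)‖ := by
    rw [hc]; congr 1; module
  have n₃ : ‖c - (q + a + b)‖ = ‖(1 / 2 : ℝ) • (a + b)‖ := by
    rw [← norm_neg, hc]; congr 1; module
  have hh : ‖(1 / 2 : ℝ) • (a + b)‖ = ‖(1 / 2 : ℝ) • (a - b)‖ := by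
    rw [norm_smul, norm_smul, hnorm]
  have m₁ := (h.norm_sub_eq_iff hcB hq hqa).1 (by rw [n₀, n₁, hh])
  have m₂ := (h.norm_sub_eq_iff hcB hq hqb).1 (by rw [n₀, n₂, hh])
  have m₃ := (h.norm_sub_eq_iff hcB hq hqab).1 (by rw [n₀, n₃])
  have hsum : g (q + a + b) = g q + (g (q + a) - g q) + (g (q + b) - g q) := by
    rw [← sub_eq_zero, ← sub_eq_zero.2 hpar]; abel
  generalize hA : f c - g q = A at *
  have w₁ : f c - g (q + a) = A - (g (q + a) - g q) := by rw [← hA]; abel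
  have w₂ : f c - g (q + b) = A - (g (q + b) - g q) := by rw [← hA]; abel
  have w₃ : f c - g (q + a + b) = A - ((g (q + a) - g q) + (g (q + b) - g q)) := by
    rw [hsum, ← hA]; abel
  rw [w₁, ← pow_left_inj₀ (norm_nonneg _) (norm_nonneg _) two_ne_zero, norm_sub_sq_real] at m₁
  rw [w₂, ← pow_left_inj₀ (norm_nonneg _) (norm_nonneg _) two_ne_zero, norm_sub_sq_real] at m₂
  rw [w₃, ← pow_left_inj₀ (norm_nonneg _) (norm_nonneg _) two_ne_zero, norm_sub_sq_real,
    norm_add_sq_real, inner_add_right] at m₃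
  linarith

/-- `g` preserves midpoints of short segments. -/
lemma apply_add_apply_sub [FiniteDimensional ℝ E] (h : IsIsotonicPair B f g) (hBo : IsOpen B)
    (hBc : Convex ℝ B) (hdim : 2 ≤ finrank ℝ E) {c v : E} {ρ : ℝ}
    (hball : Metric.ball c ρ ⊆ B) (hv : ‖v‖ < ρ / 2) :
    g (c + v) + g (c - v) = g c + g c := by
  rcases eq_or_ne v 0 with rfl | hv0
  · simp
  obtain ⟨w, hw0, hvw, hnorm⟩ := exists_orthogonal_norm_eq hdim hv0
  have hnear : ∀ z : E, ‖z‖ < ρ → c + z ∈ B := fun z hz => hball (by simpa using hz)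
  have horth : ∀ a b : E, a ≠ 0 → b ≠ 0 → ⟪a, b⟫ = 0 → ‖a‖ = ‖v‖ → ‖b‖ = ‖v‖ →
      ⟪g (c + a) - g c, g (c + b) - g c⟫ = 0 := by
    intro a b ha hb hab hna hnb
    have h0 := norm_nonneg v
    refine h.inner_apply_rectangle hBo hBc ha hb hab (by simpa using hnear 0 (by simp; linarith))
      (hnear _ (by linarith)) (hnear _ (by linarith)) ?_
    rw [add_assoc]
    exact hnear _ ((norm_add_le a b).trans_lt (by linarith))
  have i₁ := horth v w hv0 hw0 hvw rfl hnorm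
  have i₂ := horth v (-w) hv0 (neg_ne_zero.2 hw0) (by simpa using hvw) rfl (by simpa using hnorm)
  have i₃ := horth (-v) w (neg_ne_zero.2 hv0) hw0 (by simpa using hvw) (by simp) hnorm
  have i₄ := horth (-v) (-w) (neg_ne_zero.2 hv0) (neg_ne_zero.2 hw0) (by simpa using hvw) (by simp)
    (by simpa using hnorm)
  have hwv : ⟪w, v⟫ = 0 := by rwa [real_inner_comm]
  have hpos : 0 < ‖v‖ := norm_pos_iff.2 hv0
  have hpar := h.apply_rectangle hBo hBc (q := c + -v) (a := v + w) (b := v + -w)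
    (fun h0 => by
      have : ⟪v, v + w⟫ = 0 := by rw [h0, inner_zero_right]
      rw [inner_add_right, hvw, add_zero] at this
      exact hv0 (inner_self_eq_zero.1 this))
    (fun h0 => by
      have : ⟪v, v + -w⟫ = 0 := by rw [h0, inner_zero_right]
      rw [inner_add_right, inner_neg_right, hvw, neg_zero, add_zero] at this
      exact hv0 (inner_self_eq_zero.1 this))
    (by
      simp only [inner_add_left, inner_add_right, inner_neg_right, hvw, hwv,
        real_inner_self_eq_norm_sq, hnorm]
      ring)
    (hnear _ (by rw [norm_neg]; linarith))
    (by convert hnear w (by linarith) using 1; abel)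
    (by convert hnear (-w) (by rw [norm_neg]; linarith) using 1; abel)
    (by convert hnear v (by linarith) using 1; abel)
  rw [show c + -v + (v + w) + (v + -w) = c + v by abel, show c + -v + (v + w) = c + w by abel,
    show c + -v + (v + -w) = c + -w by abel] at hpar
  have hX : (g (c + v) - g c) + (g (c + -v) - g c) =
      (g (c + w) - g c) + (g (c + -w) - g c) := by
    rw [← sub_eq_zero, ← sub_eq_zero.2 hpar]; abel
  have hXX : ⟪(g (c + v) - g c) + (g (c + -v) - g c),
      (g (c + v) - g c) + (g (c + -v) - g c)⟫ = 0 := by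
    nth_rewrite 2 [hX]
    rw [inner_add_left, inner_add_right, inner_add_right, i₁, i₂, i₃, i₄]
    simp
  rw [sub_eq_add_neg, ← sub_eq_zero, ← inner_self_eq_zero.1 hXX]
  abel

/-- `g` maps parallelograms to parallelograms. -/
lemma apply_parallelogram [FiniteDimensional ℝ E] {z : E} {R : ℝ}
    (h : IsIsotonicPair (Metric.ball z R) f g) (hdim : 2 ≤ finrank ℝ E) {q a b : E}
    (hq : q ∈ Metric.ball z R) (hqa : q + a ∈ Metric.ball z R) (hqb : q + b ∈ Metric.ball z R)
    (hqab : q + a + b ∈ Metric.ball z R) :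
    g q + g (q + a + b) = g (q + a) + g (q + b) := by
  obtain ⟨R', hR', hcl⟩ : ∃ R' < R, ∀ y ∈ ({q, q + a, q + b, q + a + b} : Set E),
      y ∈ Metric.closedBall z R' := by
    refine ⟨max (max (dist q z) (dist (q + a) z)) (max (dist (q + b) z) (dist (q + a + b) z)),
      by simp_all, ?_⟩
    simp
  have hconv := convex_closedBall z R'
  have hcomb : ∀ s t : ℝ, 0 ≤ s → s ≤ 1 → 0 ≤ t → t ≤ 1 →
      q + s • a + t • b ∈ Metric.closedBall z R' := by
    intro s t hs hs' ht ht'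
    have h₁ := hconv (hcl q (by simp)) (hcl (q + a) (by simp)) (sub_nonneg.2 hs') hs (by ring)
    have h₂ := hconv (hcl (q + b) (by simp)) (hcl (q + a + b) (by simp)) (sub_nonneg.2 hs') hs
      (by ring)
    convert hconv h₁ h₂ (sub_nonneg.2 ht') ht (by ring) using 1
    module
  obtain ⟨n, hn⟩ := exists_nat_gt ((‖a‖ + ‖b‖) / (R - R'))
  have hRR : 0 < R - R' := sub_pos.2 hR'
  have hn0 : (0 : ℝ) < n := lt_of_le_of_lt (by positivity) hn
  have hsmall : ∀ w : E, ‖w‖ ≤ ‖a‖ + ‖b‖ → ‖(1 / (2 * n) : ℝ) • w‖ < (R - R') / 2 := by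
    intro w hw
    rw [div_lt_iff₀ hRR] at hn
    rw [norm_smul, Real.norm_of_nonneg (by positivity), one_div_mul_eq_div,
      div_lt_iff₀ (by positivity)]
    nlinarith
  have hcell : ∀ i < n, ∀ j < n,
      g (q + ((i : ℝ) / n) • a + ((j : ℝ) / n) • b) +
        g (q + (((i + 1 : ℕ) : ℝ) / n) • a + (((j + 1 : ℕ) : ℝ) / n) • b) =
      g (q + (((i + 1 : ℕ) : ℝ) / n) • a + ((j : ℝ) / n) • b) +
        g (q + ((i : ℝ) / n) • a + (((j + 1 : ℕ) : ℝ) / n) • b) := by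
    intro i hi j hj
    have hi' : (i : ℝ) + 1 ≤ n := by exact_mod_cast hi
    have hj' : (j : ℝ) + 1 ≤ n := by exact_mod_cast hj
    set c := q + ((i + 1 / 2 : ℝ) / n) • a + ((j + 1 / 2 : ℝ) / n) • b with hc
    have hcB : c ∈ Metric.closedBall z R' :=
      hcomb _ _ (by positivity) ((div_le_one hn0).2 (by linarith)) (by positivity)
        ((div_le_one hn0).2 (by linarith))
    have hball : Metric.ball c (R - R') ⊆ Metric.ball z R :=
      Metric.ball_subset_ball' (by linarith [Metric.mem_closedBall.1 hcB])
    have hmid := fun w hw => h.apply_add_apply_sub Metric.isOpen_ball (convex_ball z R) hdim hball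
      (hsmall w hw)
    have h₁ := hmid (a + b) (norm_add_le a b)
    have h₂ := hmid (a - b) (norm_sub_le a b)
    rw [← h₂, add_comm] at h₁
    push_cast
    convert h₁ using 3 <;> rw [hc] <;> match_scalars <;> field_simp <;> ring
  have hgrid : ∀ i ≤ n, ∀ j ≤ n,
      g q + g (q + ((i : ℝ) / n) • a + ((j : ℝ) / n) • b) =
      g (q + ((i : ℝ) / n) • a) + g (q + ((j : ℝ) / n) • b) := by
    intro i
    induction i with
    | zero => simp
    | succ i ihi =>
      intro hi j
      induction j with
      | zero => simp [add_comm]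
      | succ j ihj =>
        intro hj
        have e₁ := ihi (by omega) j (by omega)
        have e₂ := ihi (by omega) (j + 1) hj
        have e₃ := ihj (by omega)
        have e₄ := hcell i (by omega) j (by omega)
        grind
  simpa [hn0.ne'] using hgrid n le_rfl n le_rfl

end IsIsotonicPair

end IsotonicPairs


/-- **Lemma: additivity of `g`.** Let `p ≥ 1`, let `B ⊆ ℝ^p` be
a non-empty open ball containing `0`, and let `(f, g)` be an isotonic unfolding
pair on `(B, B)` with `g 0 = 0`. Then `g (y₀ + y₁) = g y₀ + g y₁` whenever
`y₀, y₁ ∈ B` are linearly independent and `y₀ + y₁ ∈ B`. -/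
theorem internal_unfolding_additive
    (p : ℕ) (hp : 1 ≤ p) (B : Set (EuclideanSpace ℝ (Fin p)))
    (hB : ∃ (z : EuclideanSpace ℝ (Fin p)) (r : ℝ), 0 < r ∧ B = Metric.ball z r)
    (h0 : (0 : EuclideanSpace ℝ (Fin p)) ∈ B)
    (f g : EuclideanSpace ℝ (Fin p) → EuclideanSpace ℝ (Fin p))
    (hf_inj : Set.InjOn f B) (hg_inj : Set.InjOn g B)
    (hpair : ∀ x ∈ B, ∀ y ∈ B, ∀ y' ∈ B,
      (‖x - y‖ < ‖x - y'‖ ↔ ‖f x - g y‖ < ‖f x - g y'‖))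
    (hg0 : g 0 = 0)
    (y₀ y₁ : EuclideanSpace ℝ (Fin p)) (hy₀ : y₀ ∈ B) (hy₁ : y₁ ∈ B)
    (hind : LinearIndependent ℝ ![y₀, y₁]) (hsum : y₀ + y₁ ∈ B) :
    g (y₀ + y₁) = g y₀ + g y₁ := by
  obtain ⟨z, r, -, rfl⟩ := hB
  have hdim : 2 ≤ finrank ℝ (EuclideanSpace ℝ (Fin p)) := by
    simpa using hind.fintype_card_le_finrank
  have h : IsIsotonicPair (Metric.ball z r) f g := hpair
  simpa [hg0] using h.apply_parallelogram hdim (q := 0) (a := y₀) (b := y₁) h0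
    (by rwa [zero_add]) (by rwa [zero_add]) (by rwa [zero_add])
end

section
/- Let p ≥ 2, let X ⊆ S^{p−1} contain p + 1 vectors in general position, and let Y ⊆ ℝ^p be open and connected. If f : X → S^{p−1} and g : Y → ℝ^p form an isotonic vector-unfolding pair on (X, Y), then there exist an invertible linear map L : ℝ^p → ℝ^p and a vector τ ∈ ℝ^p such that g(y) = L(y) + τ for all y ∈ Y, and f(x) = (L*)⁻¹(x) / ‖(L*)⁻¹(x)‖ for all x ∈ X, where L* denotes the adjoint (transpose) of L. -/
open scoped RealInnerProductSpace

/-- A monotone function on an open connected set of reals whose increments are locally invariant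
under translation is affine. -/
theorem MonotoneOn.exists_affine_of_locally_translation_invariant {I : Set ℝ} (hI : IsOpen I)
    (hconn : IsPreconnected I) {φ : ℝ → ℝ} (hφ : MonotoneOn φ I)
    (hinv : ∀ t ∈ I, ∃ δ > 0, ∀ r s : ℝ, |r| < δ → |s| < δ →
      φ (t + r + s) - φ (t + r) = φ (t + s) - φ t) :
    ∃ m b : ℝ, ∀ t ∈ I, φ t = m * t + b := by
  have hloc : ∀ t ∈ I, ∃ m, ∀ᶠ t' in nhds t, HasDerivAt φ m t' := by
    intro t ht
    obtain ⟨δ, hδ, hinv⟩ := hinv t ht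
    obtain ⟨ε, hε, hball⟩ := Metric.isOpen_iff.1 hI t ht
    set η := min δ ε
    have hη : 0 < η := lt_min hδ hε
    have hsub : Metric.ball t η ⊆ I :=
      (Metric.ball_subset_ball (min_le_right _ _)).trans hball
    obtain ⟨t₁, ht₁, hd⟩ : ∃ t₁ ∈ Metric.ball t η, DifferentiableAt ℝ φ t₁ := by
      by_contra! hcon
      have hae := (hφ.mono hsub).ae_differentiableWithinAt_of_mem
      have hnull : MeasureTheory.volume (Metric.ball t η) = 0 := by
        refine MeasureTheory.measure_mono_null ?_ hae
        intro z hz hz'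
        exact hcon z hz ((hz' hz).differentiableAt (Metric.isOpen_ball.mem_nhds hz))
      exact (Metric.measure_ball_pos MeasureTheory.volume t hη).ne' hnull
    have hsmall : ∀ᶠ s : ℝ in nhds 0, |s| < δ := by
      filter_upwards [Metric.ball_mem_nhds (0 : ℝ) hδ] with s hs
      simpa [Real.dist_eq] using hs
    have ht₁' : |t₁ - t| < δ := by
      have := Metric.mem_ball.1 ht₁
      rw [Real.dist_eq] at this
      exact this.trans_le (min_le_left _ _)
    have hd₀ : HasDerivAt (fun s => φ (t + s)) (deriv φ t₁) 0 := by
      have h₁ : HasDerivAt (fun s => φ (t₁ + s)) (deriv φ t₁) 0 :=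
        HasDerivAt.comp_const_add t₁ 0 (by simpa using hd.hasDerivAt)
      refine (h₁.add_const (φ t - φ t₁)).congr_of_eventuallyEq ?_
      filter_upwards [hsmall] with s hs
      have := hinv (t₁ - t) s ht₁' hs
      simp only [add_sub_cancel] at this
      linarith
    refine ⟨deriv φ t₁, ?_⟩
    filter_upwards [Metric.ball_mem_nhds t hδ] with t' ht'
    rw [Metric.mem_ball, Real.dist_eq] at ht'
    have h₂ : HasDerivAt (fun s => φ (t' + s)) (deriv φ t₁) 0 := by
      refine (hd₀.add_const (φ t' - φ t)).congr_of_eventuallyEq ?_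
      filter_upwards [hsmall] with s hs
      have := hinv (t' - t) s ht' hs
      simp only [add_sub_cancel] at this
      linarith
    have h₃ : HasDerivAt (fun s => φ (t' + s)) (deriv φ t₁) (t' - t') := by simpa using h₂
    simpa using h₃.comp_sub_const t' t'
  have hdd : ∀ t ∈ I, HasDerivAt (deriv φ) 0 t := by
    intro t ht
    obtain ⟨m, hm⟩ := hloc t ht
    exact (hasDerivAt_const t m).congr_of_eventuallyEq (hm.mono fun _ h => h.deriv)
  have hd : ∀ t ∈ I, DifferentiableAt ℝ φ t := by
    intro t ht
    obtain ⟨m, hm⟩ := hloc t ht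
    exact hm.self_of_nhds.differentiableAt
  obtain ⟨m, hm⟩ := hI.exists_is_const_of_deriv_eq_zero hconn
    (fun t ht => (hdd t ht).differentiableAt.differentiableWithinAt)
    (fun t ht => (hdd t ht).deriv)
  have hdm : ∀ t ∈ I, HasDerivAt (fun t => φ t - m * t) 0 t := by
    intro t ht
    have h := (hd t ht).hasDerivAt.sub ((hasDerivAt_id t).const_mul m)
    rw [hm t ht, mul_one, sub_self] at h
    exact h
  obtain ⟨b, hb⟩ := hI.exists_is_const_of_deriv_eq_zero hconn
    (fun t ht => (hdm t ht).differentiableAt.differentiableWithinAt)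
    (fun t ht => (hdm t ht).deriv)
  exact ⟨m, b, fun t ht => by linarith [hb t ht]⟩

section InnerProductSpace

variable {E : Type*} [NormedAddCommGroup E] [InnerProductSpace ℝ E]

/-- Two vectors that are positive on the same directions are positive multiples of each other. -/
theorem exists_pos_smul_eq_of_forall_inner_pos_iff {x w : E} (hx : ‖x‖ = 1)
    (h : ∀ v, 0 < ⟪x, v⟫ ↔ 0 < ⟪w, v⟫) : ∃ c : ℝ, 0 < c ∧ w = c • x := by
  have hxx : ⟪x, x⟫ = (1 : ℝ) := by rw [real_inner_self_eq_norm_sq, hx, one_pow]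
  refine ⟨⟪w, x⟫, (h x).1 (by rw [hxx]; exact one_pos), ?_⟩
  have horth : ⟪x, w - ⟪w, x⟫ • x⟫ = (0 : ℝ) := by
    rw [inner_sub_right, real_inner_smul_right, hxx, real_inner_comm, mul_one, sub_self]
  have hnot : ¬ (0 : ℝ) < ⟪w, w - ⟪w, x⟫ • x⟫ := by
    rw [← h, horth]
    exact lt_irrefl 0
  have hself : ⟪w - ⟪w, x⟫ • x, w - ⟪w, x⟫ • x⟫ = ⟪w, w - ⟪w, x⟫ • x⟫ := by
    rw [inner_sub_left _ _ (w - _), real_inner_smul_left, horth, mul_zero, sub_zero]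
  have hzero := real_inner_self_nonpos.1 (hself.trans_le (not_lt.1 hnot))
  exact sub_eq_zero.1 hzero

/-- A linearly independent family has a dual vector for each of its members. -/
theorem LinearIndependent.exists_inner_eq_one_of_forall_ne [FiniteDimensional ℝ E] {ι : Type*}
    {x : ι → E} (hx : LinearIndependent ℝ x) (i : ι) :
    ∃ v : E, ⟪x i, v⟫ = (1 : ℝ) ∧ ∀ l, l ≠ i → ⟪x l, v⟫ = (0 : ℝ) := by
  classical
  obtain ⟨F, hF⟩ := LinearMap.exists_leftInverse_of_injective
    (Finsupp.linearCombination ℝ x) (LinearMap.ker_eq_bot.2 hx)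
  set ψ : StrongDual ℝ E := LinearMap.toContinuousLinearMap (Finsupp.lapply i ∘ₗ F)
  have hψ : ∀ l, ψ (x l) = Finsupp.single l (1 : ℝ) i := by
    intro l
    have := LinearMap.congr_fun hF (Finsupp.single l 1)
    simp only [LinearMap.comp_apply, Finsupp.linearCombination_single, one_smul,
      LinearMap.id_apply] at this
    simp [ψ, this]
  refine ⟨(InnerProductSpace.toDual ℝ E).symm ψ, ?_, fun l hl => ?_⟩
  · rw [real_inner_comm, InnerProductSpace.toDual_symm_apply, hψ, Finsupp.single_eq_same]
  · rw [real_inner_comm, InnerProductSpace.toDual_symm_apply, hψ, Finsupp.single_eq_of_ne hl.symm]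

/-- Order-equivalent functionals differ by a strictly monotone change of variable. -/
theorem exists_strictMonoOn_of_inner_lt_iff {x u : E} {Y : Set E} {g : E → E}
    (h : ∀ y ∈ Y, ∀ y' ∈ Y, (⟪x, y⟫ < ⟪x, y'⟫ ↔ ⟪u, g y⟫ < ⟪u, g y'⟫)) :
    ∃ φ : ℝ → ℝ, StrictMonoOn φ ((fun y => ⟪x, y⟫) '' Y) ∧ ∀ y ∈ Y, ⟪u, g y⟫ = φ ⟪x, y⟫ := by
  have heq : ∀ y ∈ Y, ∀ y' ∈ Y, ⟪x, y⟫ = ⟪x, y'⟫ → ⟪u, g y⟫ = ⟪u, g y'⟫ := by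
    intro y hy y' hy' he
    refine le_antisymm (not_lt.1 ?_) (not_lt.1 ?_)
    · rw [← h y' hy' y hy, he]; exact lt_irrefl _
    · rw [← h y hy y' hy', he]; exact lt_irrefl _
  classical
  refine ⟨fun t => if ht : ∃ y ∈ Y, ⟪x, y⟫ = t then ⟪u, g ht.choose⟫ else 0, ?_⟩
  have hval : ∀ y ∈ Y, ⟪u, g y⟫ =
      (fun t => if ht : ∃ y ∈ Y, ⟪x, y⟫ = t then ⟪u, g ht.choose⟫ else 0) ⟪x, y⟫ := by
    intro y hy
    have hex : ∃ z ∈ Y, ⟪x, z⟫ = ⟪x, y⟫ := ⟨y, hy, rfl⟩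
    simp only [dif_pos hex]
    exact heq y hy _ hex.choose_spec.1 hex.choose_spec.2.symm
  refine ⟨?_, hval⟩
  rintro _ ⟨y, hy, rfl⟩ _ ⟨y', hy', rfl⟩ hlt
  simp only at hlt
  have := (h y hy y' hy').1 hlt
  rwa [hval y hy, hval y' hy'] at this

/-- Small translations of a point of an open set stay in the set. -/
theorem IsOpen.exists_forall_abs_lt_add_smul_mem {Y : Set E} (hY : IsOpen Y) {y : E} (hy : y ∈ Y)
    (v w : E) : ∃ δ > 0, ∀ r s : ℝ, |r| < δ → |s| < δ → y + r • v + s • w ∈ Y := by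
  have hcont : Continuous fun q : ℝ × ℝ => y + q.1 • v + q.2 • w := by fun_prop
  have hmem : (0 : ℝ × ℝ) ∈ (fun q : ℝ × ℝ => y + q.1 • v + q.2 • w) ⁻¹' Y := by simpa using hy
  obtain ⟨δ, hδ, hball⟩ := Metric.isOpen_iff.1 (hY.preimage hcont) 0 hmem
  refine ⟨δ, hδ, fun r s hr hs => hball (a := (r, s)) ?_⟩
  rw [Metric.mem_ball, dist_zero_right, Prod.norm_def]
  exact max_lt hr hs

/-- The image of an open set under the inner product with a nonzero vector is open. -/
theorem IsOpen.image_inner {Y : Set E} (hY : IsOpen Y) {x : E} (hx : x ≠ 0) :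
    IsOpen ((fun y => ⟪x, y⟫) '' Y) := by
  rw [Metric.isOpen_iff]
  rintro _ ⟨y, hy, rfl⟩
  have hxx : ⟪x, x⟫ ≠ (0 : ℝ) := inner_self_ne_zero.2 hx
  obtain ⟨δ, hδ, hmem⟩ := hY.exists_forall_abs_lt_add_smul_mem hy ((⟪x, x⟫ : ℝ)⁻¹ • x) 0
  refine ⟨δ, hδ, fun t ht => ⟨_, hmem (t - ⟪x, y⟫) 0 ?_ (by simpa using hδ), ?_⟩⟩
  · rwa [Metric.mem_ball, Real.dist_eq] at ht
  · simp only [zero_smul, add_zero, inner_add_right, real_inner_smul_right, inv_mul_cancel₀ hxx]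
    ring

end InnerProductSpace

section Finite

variable {E ι : Type*} [NormedAddCommGroup E] [InnerProductSpace ℝ E] [FiniteDimensional ℝ E]
  [Fintype ι] {x u : ι → E} {Y : Set E} {g : E → E}

/-- The family `u` inherits from `x` the independence of the subfamily omitting `k`. -/
theorem eq_zero_of_sum_smul_eq_zero_of_inner_lt_iff (hY : IsOpen Y) (hne : Y.Nonempty)
    (h : ∀ i, ∀ y ∈ Y, ∀ y' ∈ Y, (⟪x i, y⟫ < ⟪x i, y'⟫ ↔ ⟪u i, g y⟫ < ⟪u i, g y'⟫))
    {k : ι} (hx : LinearIndependent ℝ fun l : {l : ι // l ≠ k} => x l)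
    {c : ι → ℝ} (hc : ∑ l, c l • u l = 0) (hck : c k = 0) : c = 0 := by
  classical
  funext i
  by_cases hik : i = k
  · rw [hik, hck, Pi.zero_apply]
  obtain ⟨v, hv, hv'⟩ := hx.exists_inner_eq_one_of_forall_ne ⟨i, hik⟩
  obtain ⟨y, hy⟩ := hne
  obtain ⟨δ, hδ, hmem⟩ := hY.exists_forall_abs_lt_add_smul_mem hy v 0
  have hz : y + (δ / 2) • v ∈ Y := by
    have h₀ := hmem (δ / 2) 0 (by rw [abs_of_pos (by positivity)]; linarith) (by simpa using hδ)
    simpa using h₀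
  have hsum : ∑ l, c l * ⟪u l, g (y + (δ / 2) • v) - g y⟫ = 0 := by
    simpa [sum_inner, real_inner_smul_left] using congrArg
      (fun z : E => ⟪z, g (y + (δ / 2) • v) - g y⟫) hc
  have hi : ⟪x i, y⟫ < ⟪x i, y + (δ / 2) • v⟫ := by
    rw [inner_add_right, real_inner_smul_right, hv]
    linarith
  rw [Finset.sum_eq_single i] at hsum
  · rcases mul_eq_zero.1 hsum with h₁ | h₁
    · exact h₁
    · rw [inner_sub_right] at h₁
      linarith [(h i y hy _ hz).1 hi]
  · intro l _ hli
    by_cases hlk : l = k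
    · rw [hlk, hck, zero_mul]
    · obtain ⟨φ, -, hφ⟩ := exists_strictMonoOn_of_inner_lt_iff (h l)
      have hl : ⟪x l, v⟫ = (0 : ℝ) := hv' ⟨l, hlk⟩ (by simpa [Subtype.ext_iff] using hli)
      rw [inner_sub_right, hφ _ hz, hφ _ hy, inner_add_right, real_inner_smul_right, hl]
      simp
  · simp

/-- Each coordinate of `g` is a nonconstant affine function of the corresponding coordinate. -/
theorem exists_affine_of_inner_lt_iff (hY : IsOpen Y) (hconn : IsConnected Y)
    (h : ∀ i, ∀ y ∈ Y, ∀ y' ∈ Y, (⟪x i, y⟫ < ⟪x i, y'⟫ ↔ ⟪u i, g y⟫ < ⟪u i, g y'⟫))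
    (hx : ∀ k, LinearIndependent ℝ fun l : {l : ι // l ≠ k} => x l)
    {c : ι → ℝ} (hc : ∑ l, c l • u l = 0) (i j k : ι) (hci : c i ≠ 0)
    (hij : i ≠ j) (hik : i ≠ k) (hjk : j ≠ k) :
    ∃ m b : ℝ, m ≠ 0 ∧ ∀ y ∈ Y, ⟪u i, g y⟫ = m * ⟪x i, y⟫ + b := by
  classical
  have hxi : x i ≠ 0 := (hx j).ne_zero ⟨i, hij⟩
  choose φ hmono hφ using fun l => exists_strictMonoOn_of_inner_lt_iff (h l)
  obtain ⟨v, hv, hv'⟩ := (hx j).exists_inner_eq_one_of_forall_ne ⟨i, hij⟩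
  obtain ⟨w, hw, hw'⟩ := (hx k).exists_inner_eq_one_of_forall_ne ⟨i, hik⟩
  have hvl : ∀ l, l ≠ i → l ≠ j → ⟪x l, v⟫ = (0 : ℝ) := fun l hli hlj =>
    hv' ⟨l, hlj⟩ (by simpa [Subtype.ext_iff] using hli)
  have hwj : ⟪x j, w⟫ = (0 : ℝ) := hw' ⟨j, hjk⟩ (by simpa [Subtype.ext_iff] using hij.symm)
  simp only at hv hw
  have hstep : ∀ y ∈ Y, ∀ s : ℝ, y + s • v ∈ Y →
      c i * (φ i (⟪x i, y⟫ + s) - φ i ⟪x i, y⟫) +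
        c j * (φ j (⟪x j, y⟫ + s * ⟪x j, v⟫) - φ j ⟪x j, y⟫) = 0 := by
    intro y hy s hs
    have hsum : ∑ l, c l * ⟪u l, g (y + s • v) - g y⟫ = 0 := by
      simpa [sum_inner, real_inner_smul_left] using congrArg
        (fun z : E => ⟪z, g (y + s • v) - g y⟫) hc
    simp only [inner_sub_right, hφ _ _ hs, hφ _ _ hy, inner_add_right,
      real_inner_smul_right] at hsum
    rw [Fintype.sum_eq_add i j hij] at hsum
    · simpa [hv] using hsum
    · rintro l ⟨hli, hlj⟩
      simp [hvl l hli hlj]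
  obtain ⟨m, b, hmb⟩ := MonotoneOn.exists_affine_of_locally_translation_invariant
    (hY.image_inner hxi) (hconn.isPreconnected.image _ (by fun_prop)) (hmono i).monotoneOn (by
      rintro _ ⟨y, hy, rfl⟩
      obtain ⟨δ, hδ, hmem⟩ := hY.exists_forall_abs_lt_add_smul_mem hy w v
      refine ⟨δ, hδ, fun r s hr hs => ?_⟩
      have h₀ : |(0 : ℝ)| < δ := by simpa using hδ
      have h₁ := hstep (y + r • w) (by simpa using hmem r 0 hr h₀) s (hmem r s hr hs)
      have h₂ := hstep y hy s (by simpa using hmem 0 s h₀ hs)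
      simp only [inner_add_right, real_inner_smul_right, hw, hwj, mul_one, mul_zero,
        add_zero] at h₁
      exact mul_left_cancel₀ hci (by linarith))
  have haff : ∀ y ∈ Y, ⟪u i, g y⟫ = m * ⟪x i, y⟫ + b := fun y hy => by
    rw [hφ i y hy, hmb _ ⟨y, hy, rfl⟩]
  refine ⟨m, b, ?_, haff⟩
  rintro rfl
  obtain ⟨y, hy⟩ := hconn.nonempty
  obtain ⟨δ, hδ, hmem⟩ := hY.exists_forall_abs_lt_add_smul_mem hy v 0
  have hz : y + (δ / 2) • v ∈ Y := by
    have h₀ := hmem (δ / 2) 0 (by rw [abs_of_pos (by positivity)]; linarith) (by simpa using hδ)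
    simpa using h₀
  have hi : ⟪x i, y⟫ < ⟪x i, y + (δ / 2) • v⟫ := by
    rw [inner_add_right, real_inner_smul_right, hv]
    linarith
  have hlt := (h i y hy _ hz).1 hi
  rw [haff y hy, haff _ hz] at hlt
  simp at hlt

end Finite

/-- The adjoint of a linear equivalence, as a linear equivalence. -/
noncomputable def LinearEquiv.adjointEquiv {E : Type*} [NormedAddCommGroup E]
    [InnerProductSpace ℝ E] [FiniteDimensional ℝ E] (M : E ≃ₗ[ℝ] E) : E ≃ₗ[ℝ] E :=
  LinearEquiv.ofLinearMap (LinearMap.adjoint M.toLinearMap) (LinearMap.adjoint M.symm.toLinearMap)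
    (by rw [← LinearMap.adjoint_comp]; simp)
    (by rw [← LinearMap.adjoint_comp]; simp)

/-- **Theorem: internal unfolding, vector model.** Let `p ≥ 2`,
let `X ⊆ S^{p−1}` contain `p + 1` vectors in general position, and let
`Y ⊆ ℝ^p` be open and connected. If `(f, g)` is an isotonic vector-unfolding
pair on `(X, Y)`, then there are an invertible linear map `L` and a vector `τ`
such that `g y = L y + τ` on `Y` and `f x = (L*)⁻¹ x / ‖(L*)⁻¹ x‖` on `X`,
where `L*` is the adjoint of `L` (so that `(L*)⁻¹ = (L⁻¹)*`). -/
theorem internal_unfolding_vector_model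
    (p : ℕ) (hp : 2 ≤ p) (X Y : Set (EuclideanSpace ℝ (Fin p)))
    (hX : X ⊆ Metric.sphere (0 : EuclideanSpace ℝ (Fin p)) 1)
    (hgen : ∃ x : Fin (p + 1) → EuclideanSpace ℝ (Fin p),
      (∀ i, x i ∈ X) ∧
      ∀ s : Finset (Fin (p + 1)), s.card ≤ p →
        LinearIndependent ℝ (fun i : s => x (i : Fin (p + 1))))
    (hYopen : IsOpen Y) (hYconn : IsConnected Y)
    (f g : EuclideanSpace ℝ (Fin p) → EuclideanSpace ℝ (Fin p))
    (hf_maps : ∀ x ∈ X, f x ∈ Metric.sphere (0 : EuclideanSpace ℝ (Fin p)) 1)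
    (hf_inj : Set.InjOn f X) (hg_inj : Set.InjOn g Y)
    (hpair : ∀ x ∈ X, ∀ y ∈ Y, ∀ y' ∈ Y,
      (⟪x, y⟫ < ⟪x, y'⟫ ↔ ⟪f x, g y⟫ < ⟪f x, g y'⟫)) :
    ∃ (L : EuclideanSpace ℝ (Fin p) ≃ₗ[ℝ] EuclideanSpace ℝ (Fin p))
      (τ : EuclideanSpace ℝ (Fin p)),
      (∀ y ∈ Y, g y = L y + τ) ∧
      (∀ x ∈ X, f x =
        ‖(LinearMap.adjoint L.symm.toLinearMap) x‖⁻¹ •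
          (LinearMap.adjoint L.symm.toLinearMap) x) := by
  obtain ⟨x, hxX, hindep⟩ := hgen
  have hx : ∀ k, LinearIndependent ℝ fun l : {l : Fin (p + 1) // l ≠ k} => x l := by
    intro k
    have hk := hindep (Finset.univ.erase k) (by simp)
    exact hk.comp (fun l : {l : Fin (p + 1) // l ≠ k} => ⟨l.1, by simpa using l.2⟩)
      (fun a b hab => Subtype.ext (by simpa using hab))
  have h : ∀ i, ∀ y ∈ Y, ∀ y' ∈ Y,
      (⟪x i, y⟫ < ⟪x i, y'⟫ ↔ ⟪f (x i), g y⟫ < ⟪f (x i), g y'⟫) := fun i => hpair _ (hxX i)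
  have hucoef : ∀ k (c : Fin (p + 1) → ℝ), ∑ l, c l • f (x l) = 0 → c k = 0 → c = 0 :=
    fun k c hc hck => eq_zero_of_sum_smul_eq_zero_of_inner_lt_iff (u := fun l => f (x l))
      hYopen hYconn.nonempty h (hx k) hc hck
  obtain ⟨c, hc, hc0⟩ : ∃ c : Fin (p + 1) → ℝ, ∑ l, c l • f (x l) = 0 ∧ ∃ i, c i ≠ 0 := by
    refine Fintype.not_linearIndependent_iff.1 fun hli => ?_
    have := hli.fintype_card_le_finrank
    simp at this
  have hcne : ∀ i, c i ≠ 0 := by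
    intro i hi
    obtain ⟨j, hj⟩ := hc0
    exact hj (congrFun (hucoef i c hc hi) j)
  have haff : ∀ i, ∃ m b : ℝ, m ≠ 0 ∧ ∀ y ∈ Y, ⟪f (x i), g y⟫ = m * ⟪x i, y⟫ + b := by
    intro i
    obtain ⟨j, hj, k, hk, hjk⟩ := Finset.one_lt_card.1
      (show 1 < (Finset.univ.erase i).card by simp; omega)
    exact exists_affine_of_inner_lt_iff (u := fun l => f (x l)) hYopen hYconn h hx hc i j k
      (hcne i) (Finset.ne_of_mem_erase hj).symm (Finset.ne_of_mem_erase hk).symm hjk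
  choose m b hm hmb using haff
  have hxs : LinearIndependent ℝ fun l : Fin p => m l.succ • x l.succ := by
    have h₀ : LinearIndependent ℝ fun l : Fin p => x l.succ :=
      (hx 0).comp (fun l : Fin p => ⟨l.succ, l.succ_ne_zero⟩)
        (fun a b hab => Fin.succ_injective _ (congrArg Subtype.val hab))
    exact h₀.units_smul fun l => Units.mk0 _ (hm l.succ)
  have hus : LinearIndependent ℝ fun l : Fin p => f (x l.succ) := by
    refine Fintype.linearIndependent_iff.2 fun d hd l => ?_
    have := hucoef 0 (Fin.cons 0 d) (by simpa [Fin.sum_univ_succ] using hd) (by simp)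
    simpa using congrFun this l.succ
  have : Nonempty (Fin p) := ⟨⟨0, by omega⟩⟩
  let bx := basisOfLinearIndependentOfCardEqFinrank hxs (by simp)
  let bu := basisOfLinearIndependentOfCardEqFinrank hus (by simp)
  let M : EuclideanSpace ℝ (Fin p) ≃ₗ[ℝ] EuclideanSpace ℝ (Fin p) := bu.equiv bx (Equiv.refl _)
  have hM : ∀ l : Fin p, M (f (x l.succ)) = m l.succ • x l.succ := by
    intro l
    have := bu.equiv_apply l bx (Equiv.refl _)
    simpa [bu, bx, M] using this
  have hL : ∀ u y, ⟪u, M.adjointEquiv y⟫ = ⟪M u, y⟫ := fun u y =>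
    LinearMap.adjoint_inner_right M.toLinearMap u y
  obtain ⟨y₀, hy₀⟩ := hYconn.nonempty
  have hg : ∀ y ∈ Y, g y = M.adjointEquiv y + (g y₀ - M.adjointEquiv y₀) := by
    intro y hy
    refine InnerProductSpace.ext_inner_left_basis bu fun l => ?_
    have hbu : bu l = f (x l.succ) := by simp [bu]
    simp only [hbu, inner_add_right, inner_sub_right, hL, hM, real_inner_smul_left, hmb _ _ hy,
      hmb _ _ hy₀]
    ring
  refine ⟨M.adjointEquiv, g y₀ - M.adjointEquiv y₀, hg, fun z hz => ?_⟩
  have hzn : ‖z‖ = 1 := mem_sphere_zero_iff_norm.1 (hX hz)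
  have hfn : ‖f z‖ = 1 := mem_sphere_zero_iff_norm.1 (hf_maps z hz)
  have hadj : LinearMap.adjoint M.adjointEquiv.symm.toLinearMap = M.symm.toLinearMap :=
    LinearMap.adjoint_adjoint M.symm.toLinearMap
  obtain ⟨r, hr, hMz⟩ := exists_pos_smul_eq_of_forall_inner_pos_iff (x := z) (w := M (f z)) hzn (by
    intro v
    obtain ⟨δ, hδ, hmem⟩ := hYopen.exists_forall_abs_lt_add_smul_mem hy₀ v 0
    have hy : y₀ + (δ / 2) • v ∈ Y := by
      have h₀ := hmem (δ / 2) 0 (by rw [abs_of_pos (by positivity)]; linarith)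
        (by simpa using hδ)
      simpa using h₀
    have hδ2 : 0 < δ / 2 := by positivity
    have := hpair z hz y₀ hy₀ _ hy
    rw [hg _ hy, map_add, map_smul] at this
    simp only [inner_add_right, inner_sub_right, real_inner_smul_right, hL] at this
    rw [← mul_pos_iff_of_pos_left hδ2, ← mul_pos_iff_of_pos_left (b := ⟪M (f z), v⟫) hδ2]
    constructor
    · intro hv
      linarith [this.1 (by linarith)]
    · intro hv
      linarith [this.2 (by linarith)])
  have hfz : f z = r • M.symm z := by
    rw [← map_smul, ← hMz, LinearEquiv.symm_apply_apply]
  have hrn : r * ‖M.symm z‖ = 1 := by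
    rw [← hfn, hfz, norm_smul, Real.norm_of_nonneg hr.le]
  rw [hadj]
  change f z = ‖M.symm z‖⁻¹ • M.symm z
  rw [hfz, eq_inv_of_mul_eq_one_left hrn]
end

section
/- Let p ≥ 2, let X ⊆ S^{p−1}, and let Y ⊆ ℝ^p have non-empty interior. Let f : X → S^{p−1} and g : Y → ℝ^p form an isotonic vector-unfolding pair on (X, Y). If x₁, …, x_q ∈ X are linearly independent, then f(x₁), …, f(x_q) are linearly independent. -/
open scoped RealInnerProductSpace

/-- The inner products of a vector with a linearly independent family may be prescribed. -/
theorem LinearIndependent.exists_inner_eq {E ι : Type*} [NormedAddCommGroup E]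
    [InnerProductSpace ℝ E] [FiniteDimensional ℝ E] {x : ι → E}
    (hx : LinearIndependent ℝ x) (c : ι → ℝ) : ∃ v : E, ∀ i, ⟪x i, v⟫ = c i := by
  obtain ⟨r, hr⟩ := LinearMap.exists_leftInverse_of_injective
    (Finsupp.linearCombination ℝ x) (LinearMap.ker_eq_bot.2 hx)
  refine ⟨(InnerProductSpace.toDual ℝ E).symm
    (LinearMap.toContinuousLinearMap (Finsupp.linearCombination ℝ c ∘ₗ r)), fun i => ?_⟩
  have hi : r (x i) = Finsupp.single i 1 := by
    simpa using LinearMap.congr_fun hr (Finsupp.single i 1)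
  rw [real_inner_comm, InnerProductSpace.toDual_symm_apply]
  simp [hi]

/-- From an interior point of a set one can move a little in any direction within the set. -/
theorem exists_pos_add_smul_mem_of_mem_interior {E : Type*} [NormedAddCommGroup E]
    [NormedSpace ℝ E] {s : Set E} {y : E} (hy : y ∈ interior s) (v : E) :
    ∃ t : ℝ, 0 < t ∧ y + t • v ∈ s := by
  have hcont : Filter.Tendsto (fun t : ℝ => y + t • v) (nhds 0) (nhds y) :=
    (by fun_prop : Continuous fun t : ℝ => y + t • v).tendsto' 0 y (by simp)
  have hmem : ∀ᶠ t : ℝ in nhdsWithin 0 (Set.Ioi 0), y + t • v ∈ s :=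
    nhdsWithin_le_nhds (hcont.eventually (mem_interior_iff_mem_nhds.1 hy))
  obtain ⟨t, hts, ht⟩ := (hmem.and self_mem_nhdsWithin).exists
  exact ⟨t, ht, hts⟩

/-- **Lemma: `f` preserves linear independence.** Let `p ≥ 2`,
`X ⊆ S^{p−1}`, and let `Y ⊆ ℝ^p` have non-empty interior. If `(f, g)` is an
isotonic vector-unfolding pair on `(X, Y)` and `x₁, …, x_q ∈ X` are linearly
independent, then `f x₁, …, f x_q` are linearly independent. -/
theorem vector_unfolding_linear_independent
    (p : ℕ) (hp : 2 ≤ p) (X Y : Set (EuclideanSpace ℝ (Fin p)))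
    (hX : X ⊆ Metric.sphere (0 : EuclideanSpace ℝ (Fin p)) 1)
    (hY : (interior Y).Nonempty)
    (f g : EuclideanSpace ℝ (Fin p) → EuclideanSpace ℝ (Fin p))
    (hf_maps : ∀ x ∈ X, f x ∈ Metric.sphere (0 : EuclideanSpace ℝ (Fin p)) 1)
    (hf_inj : Set.InjOn f X) (hg_inj : Set.InjOn g Y)
    (hpair : ∀ x ∈ X, ∀ y ∈ Y, ∀ y' ∈ Y,
      (⟪x, y⟫ < ⟪x, y'⟫ ↔ ⟪f x, g y⟫ < ⟪f x, g y'⟫))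
    (q : ℕ) (x : Fin q → EuclideanSpace ℝ (Fin p)) (hxX : ∀ i, x i ∈ X)
    (hind : LinearIndependent ℝ x) :
    LinearIndependent ℝ (f ∘ x) := by
  rw [Fintype.linearIndependent_iff]
  intro c hc
  by_contra! hne
  obtain ⟨j, hj⟩ := hne
  obtain ⟨v, hv⟩ := hind.exists_inner_eq c
  obtain ⟨y, hy⟩ := hY
  obtain ⟨t, ht, hyt⟩ := exists_pos_add_smul_mem_of_mem_interior hy v
  have hyY := interior_subset hy
  have hpos : ∀ i, c i ≠ 0 → 0 < c i * ⟪f (x i), g (y + t • v) - g y⟫ := by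
    intro i hi
    have hinner : ⟪x i, y + t • v⟫ = ⟪x i, y⟫ + t * c i := by
      rw [inner_add_right, inner_smul_right, hv]
    rw [inner_sub_right]
    rcases hi.lt_or_gt with h | h
    · refine mul_pos_of_neg_of_neg h (sub_neg.2 ((hpair _ (hxX i) _ hyt _ hyY).1 ?_))
      linarith [mul_neg_of_pos_of_neg ht h]
    · refine mul_pos h (sub_pos.2 ((hpair _ (hxX i) _ hyY _ hyt).1 ?_))
      linarith [mul_pos ht h]
  have hsum : 0 < ∑ i, c i * ⟪f (x i), g (y + t • v) - g y⟫ := by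
    refine Finset.sum_pos' (fun i _ => ?_) ⟨j, Finset.mem_univ j, hpos j hj⟩
    by_cases hi : c i = 0
    · simp [hi]
    · exact (hpos i hi).le
  have hzero := congrArg (fun w => ⟪w, g (y + t • v) - g y⟫) hc
  simp only [sum_inner, real_inner_smul_left, Function.comp_apply, inner_zero_left] at hzero
  exact hsum.ne' hzero
end
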